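/- For odd n ≥ 7, the maximum length M_n of a self-avoiding directed cycle in the Cayley graph of S_n with generators τ_2,…,τ_n, subject to the constraint that no two permutations on the cycle differ by a single adjacent transposition, equals n!/2. -/

import Mathlib

/-- `tau n k` is the permutation of positions `{1,…,n}` (0-indexed as `Fin n`) with
`τ_k(1)=k`, `τ_k(i)=i-1` for `2 ≤ i ≤ k`, and `τ_k(i)=i` for `i > k`. -/
def tau (n k : ℕ) : Equiv.Perm (Fin n) :=
  if h : k - 1 < n then (Fin.cycleRange ⟨k - 1, h⟩)⁻¹ else 1

/-- `ρ` is an adjacent transposition: it swaps two adjacent positions `i, i+1` and fixes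
all other elements. -/
def IsAdjSwap (n : ℕ) (ρ : Equiv.Perm (Fin n)) : Prop :=
  ∃ (i : ℕ) (h1 : i < n) (h2 : i + 1 < n), ρ = Equiv.swap ⟨i, h1⟩ ⟨i + 1, h2⟩

/-- `c : ZMod L → S_n` is a self-avoiding directed cycle of length `L` in the Cayley graph
of `S_n` with generators `τ_2, …, τ_n`, no two of whose permutations differ by a single
adjacent transposition. -/
def IsGoodCycle (n L : ℕ) (c : ZMod L → Equiv.Perm (Fin n)) : Prop :=
  Function.Injective c ∧
  (∀ i : ZMod L, ∃ k, 2 ≤ k ∧ k ≤ n ∧ c (i + 1) = c i * tau n k) ∧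
  (∀ i j : ZMod L, i ≠ j → ¬ IsAdjSwap n ((c i)⁻¹ * c j))

set_option linter.unusedSectionVars false
namespace Snake
open Equiv Equiv.Perm

section generic
variable {α : Type*} [Fintype α] [DecidableEq α]

lemma sc_closed {f : Perm α} (U : Set α) (h : ∀ x ∈ U, f x ∈ U) {x y : α}
    (hxy : f.SameCycle x y) (hx : x ∈ U) : y ∈ U := by
  obtain ⟨i, -, hi⟩ := hxy.exists_pow_eq'
  rw [← hi]
  clear hi
  induction i with
  | zero => simpa using hx
  | succ k ih => rw [pow_succ', Perm.mul_apply]; exact h _ ih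

lemma sc_step (f : Perm α) (x : α) : f.SameCycle x (f x) := ⟨1, by simp⟩

lemma sc_of_rel {f g : Perm α} (h : ∀ x, g.SameCycle x (f x)) {x y : α}
    (hxy : f.SameCycle x y) : g.SameCycle x y :=
  sc_closed {y | g.SameCycle x y} (fun z hz => SameCycle.trans hz (h z)) hxy (SameCycle.refl g x)

lemma swap_val (f : Perm α) (p q : α) :
    (f * swap p q) p = f q ∧ (f * swap p q) q = f p ∧
      ∀ x, x ≠ p → x ≠ q → (f * swap p q) x = f x := by
  refine ⟨by simp, by simp, fun x h1 h2 => by simp [swap_apply_of_ne_of_ne h1 h2]⟩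

lemma merge_pq {f : Perm α} {p q : α} (h : ¬ f.SameCycle p q) :
    (f * swap p q).SameCycle p q := by
  obtain ⟨e1, e2, e3⟩ := swap_val f p q
  set g := f * swap p q
  by_contra hc
  have key : ∀ i : ℕ, g.SameCycle p ((f ^ (i+1)) q) := by
    intro i
    induction i with
    | zero => simpa [e1] using sc_step g p
    | succ k ih =>
      have h1 : (f ^ (k+1)) q ≠ q := fun h' => hc (h' ▸ ih)
      have h2 : (f ^ (k+1)) q ≠ p := fun h' => h (SameCycle.symm ⟨((k+1 : ℕ) : ℤ), by rw [zpow_natCast]; exact h'⟩)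
      have := ih.trans (sc_step g _)
      rw [e3 _ h2 h1] at this
      rw [pow_succ', Perm.mul_apply]
      exact this
  have hpos := orderOf_pos f
  have := key (orderOf f - 1)
  rw [Nat.sub_add_cancel hpos, pow_orderOf_eq_one] at this
  exact hc this

lemma merge_iff {f : Perm α} {p q : α} (h : ¬ f.SameCycle p q) (x y : α) :
    (f * swap p q).SameCycle x y ↔ f.SameCycle x y ∨
      ((f.SameCycle x p ∨ f.SameCycle x q) ∧ (f.SameCycle y p ∨ f.SameCycle y q)) := by
  have hm := merge_pq h
  obtain ⟨e1, e2, e3⟩ := swap_val f p q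
  set g := f * swap p q
  have hfg : ∀ {x y}, f.SameCycle x y → g.SameCycle x y := by
    intro x y hxy
    refine sc_of_rel (fun z => ?_) hxy
    by_cases hz : z = p
    · subst hz; rw [← e2]; exact hm.trans (sc_step g q)
    by_cases hz' : z = q
    · subst hz'; rw [← e1]; exact hm.symm.trans (sc_step g p)
    rw [← e3 z hz hz']; exact sc_step g z
  constructor
  · intro hxy
    have := sc_closed {y | f.SameCycle x y ∨
      ((f.SameCycle x p ∨ f.SameCycle x q) ∧ (f.SameCycle y p ∨ f.SameCycle y q))} ?_ hxy
      (Or.inl (SameCycle.refl f x))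
    · exact this
    intro z hz
    have s1 := sc_step f p
    have s2 := sc_step f q
    have s3 := sc_step f z
    simp only [Set.mem_ofPred_eq] at hz ⊢
    by_cases hzp : z = p
    · subst hzp; rw [e1]
      exact Or.inr ⟨by rcases hz with hz | hz; exacts [Or.inl hz, hz.1], Or.inr s2.symm⟩
    by_cases hzq : z = q
    · subst hzq; rw [e2]
      exact Or.inr ⟨by rcases hz with hz | hz; exacts [Or.inr hz, hz.1], Or.inl s1.symm⟩
    rw [e3 z hzp hzq]
    rcases hz with hz | ⟨hz, hz' | hz'⟩
    · exact Or.inl (hz.trans s3)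
    · exact Or.inr ⟨hz, Or.inl (s3.symm.trans hz')⟩
    · exact Or.inr ⟨hz, Or.inr (s3.symm.trans hz')⟩
  · rintro (hxy | ⟨hx, hy⟩)
    · exact hfg hxy
    · have hx' : g.SameCycle x p := by
        rcases hx with hx | hx
        · exact hfg hx
        · exact (hfg hx).trans hm.symm
      have hy' : g.SameCycle y p := by
        rcases hy with hy | hy
        · exact hfg hy
        · exact (hfg hy).trans hm.symm
      exact hx'.trans hy'.symm

lemma split_not {f : Perm α} {p q : α} (h : f.SameCycle p q) (hne : p ≠ q) :
    ¬ (f * swap p q).SameCycle p q := by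
  classical
  obtain ⟨e1, e2, e3⟩ := swap_val f p q
  set g := f * swap p q
  have hex : ∃ i : ℕ, 0 < i ∧ (f ^ i) q = p := by
    obtain ⟨i, -, hi⟩ := h.symm.exists_pow_eq'
    · rcases Nat.eq_zero_or_pos i with h0 | h0
      · subst h0; simp at hi; exact absurd hi.symm hne
      · exact ⟨i, h0, hi⟩
  set k := Nat.find hex with hk
  obtain ⟨hk0, hkp⟩ := Nat.find_spec hex
  have hmin : ∀ i, 0 < i → i < k → (f ^ i) q ≠ p := fun i h0 hi hp => Nat.find_min hex hi ⟨h0, hp⟩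
  have hq : ∀ i, 0 < i → i ≤ k → (f ^ i) q ≠ q := by
    intro i h0 hi hq
    rcases hi.eq_or_lt with rfl | hi
    · exact hne (hkp.symm.trans hq)
    · refine hmin (k - i) (by omega) (by omega) ?_
      rw [← hkp, ← hk]
      conv_rhs => rw [show k = (k - i) + i by omega, pow_add, Perm.mul_apply, hq]
  intro hc
  have := sc_closed {y | ∃ i, 0 < i ∧ i ≤ k ∧ (f ^ i) q = y} ?_ hc ⟨k, hk0, le_refl _, hkp⟩
  · obtain ⟨i, h0, hi, hy⟩ := this
    exact hq i h0 hi hy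
  rintro y ⟨i, h0, hi, rfl⟩
  rcases hi.eq_or_lt with rfl | hi'
  · exact ⟨1, by omega, by omega, by rw [← hk] at hkp; rw [hkp, e1]; simp⟩
  · refine ⟨i + 1, by omega, by omega, ?_⟩
    rw [e3 _ (hmin i h0 hi') (hq i h0 hi), pow_succ', Perm.mul_apply]

lemma split_cover {f : Perm α} {p q : α} {x : α} (h : f.SameCycle p x ∨ f.SameCycle q x) :
    (f * swap p q).SameCycle p x ∨ (f * swap p q).SameCycle q x := by
  obtain ⟨e1, e2, e3⟩ := swap_val f p q
  set g := f * swap p q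
  have hcl : ∀ z ∈ {z | g.SameCycle p z ∨ g.SameCycle q z}, f z ∈ {z | g.SameCycle p z ∨ g.SameCycle q z} := by
    intro z hz
    simp only [Set.mem_ofPred_eq] at hz ⊢
    by_cases hzp : z = p
    · subst hzp; right; rw [← e2]; exact sc_step g q
    by_cases hzq : z = q
    · subst hzq; left; rw [← e1]; exact sc_step g p
    rw [← e3 z hzp hzq]
    exact hz.imp (fun h => h.trans (sc_step g z)) (fun h => h.trans (sc_step g z))
  rcases h with h | h
  · exact sc_closed _ hcl h (Or.inl (SameCycle.refl g p))
  · exact sc_closed _ hcl h (Or.inr (SameCycle.refl g q))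

/-- `p ↦ q ↦ r ↦ p`. -/
def c3 (p q r : α) : Perm α := swap p q * swap q r

lemma c3_val {p q r : α} (h1 : p ≠ q) (h2 : q ≠ r) (h3 : p ≠ r) :
    c3 p q r p = q ∧ c3 p q r q = r ∧ c3 p q r r = p ∧
      ∀ x, x ≠ p → x ≠ q → x ≠ r → c3 p q r x = x := by
  unfold c3
  refine ⟨?_, ?_, ?_, ?_⟩
  · simp [swap_apply_of_ne_of_ne h1 h3]
  · simp [swap_apply_of_ne_of_ne h3.symm h2.symm]
  · simp
  · intro x hp hq hr
    simp [swap_apply_of_ne_of_ne hq hr, swap_apply_of_ne_of_ne hp hq]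

lemma tri_iff {f : Perm α} {p q r : α} (h1 : ¬ f.SameCycle p q) (h2 : ¬ f.SameCycle q r)
    (h3 : ¬ f.SameCycle p r) (x y : α) :
    (f * c3 p q r).SameCycle x y ↔ f.SameCycle x y ∨
      ((f.SameCycle x p ∨ f.SameCycle x q ∨ f.SameCycle x r) ∧
        (f.SameCycle y p ∨ f.SameCycle y q ∨ f.SameCycle y r)) := by
  unfold c3
  rw [← mul_assoc]
  have hqr : ¬ (f * swap p q).SameCycle q r := by
    rw [merge_iff h1]
    rintro (h | ⟨-, h | h⟩)
    exacts [h2 h, h3 h.symm, h2 h.symm]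
  rw [merge_iff hqr]
  simp only [merge_iff h1]
  have := SameCycle.refl f q
  have a1 : ¬ f.SameCycle r p := fun h => h3 h.symm
  have a2 : ¬ f.SameCycle r q := fun h => h2 h.symm
  have a0 : ¬ f.SameCycle q p := fun h => h1 h.symm
  simp only [a0, a1, a2, this, or_true, and_true, or_false, and_false]
  generalize f.SameCycle x y = A
  generalize f.SameCycle x p = B1
  generalize f.SameCycle x q = B2
  generalize f.SameCycle x r = B3
  generalize f.SameCycle y p = C1
  generalize f.SameCycle y q = C2
  generalize f.SameCycle y r = C3
  clear this a0 a1 a2 hqr h1 h2 h3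
  grind

/-- last triangle -/
lemma tri_last {f : Perm α} {p q e : α} (hne : p ≠ q) (h2 : ¬ f.SameCycle q e)
    (h3 : ¬ f.SameCycle p e) :
    ((f * c3 p q e).SameCycle p q ↔ ¬ f.SameCycle p q) ∧
    (∀ x, f.SameCycle p x ∨ f.SameCycle q x ∨ f.SameCycle e x →
      (f * c3 p q e).SameCycle p x ∨ (f * c3 p q e).SameCycle q x) := by
  by_cases h : f.SameCycle p q
  · have hs := split_not h hne
    have hc := fun x => split_cover (f := f) (p := p) (q := q) (x := x)
    unfold c3
    rw [← mul_assoc]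
    have hsub : ∀ {x y}, (f * swap p q).SameCycle x y → f.SameCycle x y := by
      intro x y hxy
      obtain ⟨e1, e2, e3⟩ := swap_val f p q
      refine sc_of_rel (fun z => ?_) hxy
      by_cases hz : z = p
      · subst hz; rw [e1]; exact h.trans (sc_step f q)
      by_cases hz' : z = q
      · subst hz'; rw [e2]; exact h.symm.trans (sc_step f p)
      rw [e3 z hz hz']; exact sc_step f z
    have hgs : ∀ {x}, f.SameCycle e x → (f * swap p q).SameCycle e x := by
      intro x hx
      obtain ⟨e1, e2, e3⟩ := swap_val f p q
      refine (sc_closed {x | f.SameCycle e x ∧ (f * swap p q).SameCycle e x} ?_ hx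
        ⟨SameCycle.refl _ _, SameCycle.refl _ _⟩).2
      rintro z ⟨hz, hz'⟩
      refine ⟨hz.trans (sc_step f z), ?_⟩
      rw [← e3 z (fun hh => h3 (hh ▸ hz.symm)) (fun hh => h2 (hh ▸ hz.symm))]
      exact hz'.trans (sc_step _ z)
    set g := f * swap p q
    have hqe : ¬ g.SameCycle q e := fun hh => h2 (hsub hh)
    have hpe : ¬ g.SameCycle p e := fun hh => h3 (hsub hh)
    refine ⟨?_, ?_⟩
    · rw [merge_iff hqe]; tauto
    · intro x hx
      rw [merge_iff hqe, merge_iff hqe]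
      have hcx := hc x
      have r1 := SameCycle.refl g q
      rcases hx with hx | hx | hx
      · rcases hcx (Or.inl hx) with h' | h'
        · exact Or.inl (Or.inl h')
        · exact Or.inr (Or.inl h')
      · rcases hcx (Or.inr hx) with h' | h'
        · exact Or.inl (Or.inl h')
        · exact Or.inr (Or.inl h')
      · exact Or.inr (Or.inr ⟨Or.inl r1, Or.inr (hgs hx).symm⟩)
  · simp only [tri_iff h h2 h3]
    refine ⟨?_, ?_⟩
    · have := SameCycle.refl f p
      have := SameCycle.refl f q
      tauto
    · intro x hx
      have := SameCycle.refl f p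
      have s : ∀ {a b}, f.SameCycle a b → f.SameCycle b a := fun h => h.symm
      rcases hx with hx | hx | hx
      · exact Or.inl (Or.inl hx)
      · exact Or.inr (Or.inl hx)
      · exact Or.inl (Or.inr ⟨Or.inl this, Or.inr (Or.inr (s hx))⟩)

end generic
section abstract
variable {G : Type*} [Group G] [Fintype G] [DecidableEq G]

structure Part (A : Subgroup G) (Gen : Set G) (S : Set G) (f : Perm G) : Prop where
  inv : ∀ x ∈ S, ∀ a ∈ A, x * a ∈ S
  fix : ∀ x, x ∉ S → f x = x
  gen : ∀ x ∈ S, ∃ t ∈ Gen, f x = x * t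

lemma Part.cl {A : Subgroup G} {Gen S : Set G} {f : Perm G} (P : Part A Gen S f) :
    ∀ x ∈ S, f x ∈ S := by
  intro x hx
  by_contra h
  have := f.injective (P.fix _ h)
  exact h (this.symm ▸ hx)

def cos (A : Subgroup G) (q : G) : Set G := {x | q⁻¹ * x ∈ A}

lemma mem_cos {A : Subgroup G} {q x : G} : x ∈ cos A q ↔ q⁻¹ * x ∈ A := Iff.rfl

lemma self_cos {A : Subgroup G} {q : G} : q ∈ cos A q := by simp [mem_cos, A.one_mem]

structure Ctx (A A0 : Subgroup G) (Gen : Set G) (τ τ' σ : G) (H : Perm G) : Prop where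
  hσ : σ * τ = τ'
  hσ3 : σ * σ * σ = 1
  σA : σ ∉ A
  hτ' : τ' ∈ Gen
  A0A : A0 ≤ A
  comm : ∀ a ∈ A0, a * σ = σ * a
  HP : Part A Gen A H
  Hc : ∀ x ∈ A, H.SameCycle 1 x
  Hfull : ∀ x ∈ A, ∃ a ∈ A0, H (x * a) = x * a * τ

variable {A A0 : Subgroup G} {Gen : Set G} {τ τ' σ : G} {H : Perm G}

lemma not_mem_cos {S : Set G} (hS : ∀ x ∈ S, ∀ a ∈ A, x * a ∈ S) {q x : G} (hq : q ∉ S)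
    (hx : x ∈ S) : x ∉ cos A q := by
  intro h
  apply hq
  have := hS x hx _ (A.inv_mem h)
  simpa using this

lemma add1 (c : Ctx A A0 Gen τ τ' σ H) {S : Set G} {f : Perm G} (P : Part A Gen S f) {q t : G}
    (hq : q ∉ S) (ht : t ∈ A) :
    ∃ f1, Part A Gen (S ∪ cos A q) f1 ∧ (∀ x ∈ S, f1 x = f x) ∧
      (∀ x ∈ cos A q, f1 x = q * t⁻¹ * H ((q * t⁻¹)⁻¹ * x)) ∧
      (∀ x ∈ S, ∀ y ∈ S, f1.SameCycle x y ↔ f.SameCycle x y) ∧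
      (∀ x ∈ S, ∀ y, f1.SameCycle x y → y ∈ S) ∧
      (∀ x ∈ cos A q, f1.SameCycle q x) := by
  set g := q * t⁻¹ with hg
  set C : Perm G := Equiv.mulLeft g * H * (Equiv.mulLeft g)⁻¹ with hC
  have Cval : ∀ x, C x = g * H (g⁻¹ * x) := by
    intro x; simp [hC]
  have hgq : ∀ x, x ∈ cos A q ↔ g⁻¹ * x ∈ A := by
    intro x
    rw [mem_cos, hg]
    have : (q * t⁻¹)⁻¹ * x = t * (q⁻¹ * x) := by group
    rw [this, A.mul_mem_cancel_left ht]
  have Cfix : ∀ x, x ∉ cos A q → C x = x := by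
    intro x hx
    rw [Cval, c.HP.fix _ (fun h => hx ((hgq x).2 h))]
    group
  have Ccl : ∀ x, x ∈ cos A q → C x ∈ cos A q := by
    intro x hx
    rw [hgq, Cval]
    have := c.HP.cl _ ((hgq x).1 hx)
    simpa using this
  have hdis : ∀ x ∈ S, x ∉ cos A q := fun x hx => not_mem_cos P.inv hq hx
  have v1 : ∀ x ∈ S, (f * C) x = f x := by
    intro x hx
    rw [Perm.mul_apply, Cfix x (hdis x hx)]
  have v2 : ∀ x ∈ cos A q, (f * C) x = C x := by
    intro x hx
    rw [Perm.mul_apply, P.fix]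
    exact fun h => hdis _ h (Ccl x hx)
  have hin : ∀ x ∈ S, ∀ y, (f * C).SameCycle x y → y ∈ S ∧ f.SameCycle x y := by
    intro x hx y hxy
    refine sc_closed {y | y ∈ S ∧ f.SameCycle x y} ?_ hxy ⟨hx, SameCycle.refl f x⟩
    rintro z ⟨hz, hz'⟩
    refine ⟨?_, ?_⟩
    · rw [v1 z hz]; exact P.cl z hz
    · rw [v1 z hz]; exact hz'.trans (sc_step f z)
  refine ⟨f * C, ⟨?_, ?_, ?_⟩, v1, fun x hx => by rw [v2 x hx, Cval], ?_, fun x hx y h => (hin x hx y h).1, ?_⟩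
  · rintro x (hx | hx) a ha
    · exact Or.inl (P.inv x hx a ha)
    · right
      rw [mem_cos] at hx ⊢
      rw [← mul_assoc]
      exact A.mul_mem hx ha
  · intro x hx
    rw [Set.mem_union, not_or] at hx
    rw [Perm.mul_apply, Cfix x hx.2, P.fix x hx.1]
  · rintro x (hx | hx)
    · rw [v1 x hx]; exact P.gen x hx
    · rw [v2 x hx, Cval]
      obtain ⟨s, hs, h⟩ := c.HP.gen _ ((hgq x).1 hx)
      exact ⟨s, hs, by rw [h]; group⟩
  · intro x hx y hy
    refine ⟨fun h => (hin x hx y h).2, fun h => ?_⟩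
    refine (sc_closed {y | y ∈ S ∧ (f * C).SameCycle x y} ?_ h ⟨hx, SameCycle.refl _ x⟩).2
    rintro z ⟨hz, hz'⟩
    exact ⟨P.cl z hz, by rw [← v1 z hz]; exact hz'.trans (sc_step _ z)⟩
  · intro x hx
    have h1 : H.SameCycle (g⁻¹ * q) (g⁻¹ * x) :=
      (c.Hc _ ((hgq q).1 self_cos)).symm.trans (c.Hc _ ((hgq x).1 hx))
    have h2 : C.SameCycle q x := by
      rw [hC, sameCycle_conj]
      simpa using h1
    refine (sc_closed {y | y ∈ cos A q ∧ (f * C).SameCycle q y} ?_ h2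
      ⟨self_cos, SameCycle.refl _ _⟩).2
    rintro z ⟨hz, hz'⟩
    exact ⟨Ccl z hz, by rw [← v2 z hz]; exact hz'.trans (sc_step _ z)⟩

lemma Ctx.σ1 (c : Ctx A A0 Gen τ τ' σ H) : σ ≠ 1 := fun h => c.σA (h ▸ A.one_mem)

lemma Ctx.σσA (c : Ctx A A0 Gen τ τ' σ H) : σ * σ ∉ A := by
  intro h
  apply c.σA
  have : σ = (σ * σ)⁻¹ := eq_inv_of_mul_eq_one_right c.hσ3
  rw [this]; exact A.inv_mem h

lemma Ctx.ne (c : Ctx A A0 Gen τ τ' σ H) : τ ≠ τ' := by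
  intro h
  have := c.hσ
  rw [← h] at this
  exact c.σ1 (mul_eq_right.1 this)

lemma Ctx.ne3 (c : Ctx A A0 Gen τ τ' σ H) (p : G) :
    p ≠ p * σ ∧ p * σ ≠ p * σ * σ ∧ p ≠ p * σ * σ := by
  refine ⟨?_, ?_, ?_⟩
  · intro h; exact c.σ1 (mul_eq_left.1 h.symm)
  · intro h; exact c.σ1 (mul_eq_left.1 h.symm)
  · intro h; rw [mul_assoc] at h; exact c.σσA ((mul_eq_left.1 h.symm).symm ▸ A.one_mem)

lemma triPart (c : Ctx A A0 Gen τ τ' σ H) {S : Set G} {f : Perm G} (P : Part A Gen S f) {p : G}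
    (h1 : p ∈ S) (h2 : p * σ ∈ S) (h3 : p * σ * σ ∈ S) (f1 : f p = p * τ)
    (f2 : f (p * σ) = p * σ * τ) (f3 : f (p * σ * σ) = p * σ * σ * τ) :
    Part A Gen S (f * c3 p (p * σ) (p * σ * σ)) ∧
    (f * c3 p (p * σ) (p * σ * σ)) p = p * τ' ∧
    (f * c3 p (p * σ) (p * σ * σ)) (p * σ) = p * σ * τ' ∧
    (f * c3 p (p * σ) (p * σ * σ)) (p * σ * σ) = p * σ * σ * τ' ∧
    ∀ x, x ≠ p → x ≠ p * σ → x ≠ p * σ * σ → (f * c3 p (p * σ) (p * σ * σ)) x = f x := by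
  obtain ⟨n1, n2, n3⟩ := c.ne3 p
  obtain ⟨v1, v2, v3, v4⟩ := c3_val n1 n2 n3
  have e1 : (f * c3 p (p * σ) (p * σ * σ)) p = p * τ' := by
    rw [Perm.mul_apply, v1, f2, mul_assoc, c.hσ]
  have e2 : (f * c3 p (p * σ) (p * σ * σ)) (p * σ) = p * σ * τ' := by
    rw [Perm.mul_apply, v2, f3, mul_assoc (p * σ), c.hσ]
  have e3 : (f * c3 p (p * σ) (p * σ * σ)) (p * σ * σ) = p * σ * σ * τ' := by
    rw [Perm.mul_apply, v3, f1, ← c.hσ]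
    have := c.hσ3
    calc p * τ = p * (σ * σ * σ) * τ := by rw [this, mul_one]
      _ = _ := by simp only [mul_assoc]
  have e4 : ∀ x, x ≠ p → x ≠ p * σ → x ≠ p * σ * σ → (f * c3 p (p * σ) (p * σ * σ)) x = f x := by
    intro x a b d
    rw [Perm.mul_apply, v4 x a b d]
  refine ⟨⟨P.inv, ?_, ?_⟩, e1, e2, e3, e4⟩
  · intro x hx
    rw [e4 x (fun h => hx (h ▸ h1)) (fun h => hx (h ▸ h2)) (fun h => hx (h ▸ h3)), P.fix x hx]
  · intro x hx
    by_cases a : x = p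
    · exact ⟨τ', c.hτ', a ▸ e1⟩
    by_cases b : x = p * σ
    · exact ⟨τ', c.hτ', by rw [b, e2]⟩
    by_cases d : x = p * σ * σ
    · exact ⟨τ', c.hτ', by rw [d, e3]⟩
    rw [e4 x a b d]; exact P.gen x hx

lemma attach (c : Ctx A A0 Gen τ τ' σ H) {S : Set G} {f : Perm G} (P : Part A Gen S f)
    {p t1 t2 : G} (hp : p ∈ S) (fp : f p = p * τ) (h1 : p * σ ∉ S) (h2 : p * σ * σ ∉ S)
    (ht1 : t1 ∈ A) (Ht1 : H t1 = t1 * τ) (ht2 : t2 ∈ A) (Ht2 : H t2 = t2 * τ) :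
    ∃ f1, Part A Gen (S ∪ cos A (p * σ) ∪ cos A (p * σ * σ)) f1 ∧
      (∀ x ∈ S, x ≠ p → f1 x = f x) ∧
      (∀ x ∈ cos A (p * σ), x ≠ p * σ →
        f1 x = p * σ * t1⁻¹ * H ((p * σ * t1⁻¹)⁻¹ * x)) ∧
      (∀ x ∈ cos A (p * σ * σ), x ≠ p * σ * σ →
        f1 x = p * σ * σ * t2⁻¹ * H ((p * σ * σ * t2⁻¹)⁻¹ * x)) ∧
      (∀ x ∈ S, ∀ y ∈ S, f1.SameCycle x y ↔ f.SameCycle x y) ∧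
      (∀ x ∈ cos A (p * σ), f1.SameCycle p x) ∧
      (∀ x ∈ cos A (p * σ * σ), f1.SameCycle p x) := by
  obtain ⟨fa, Pa, a1, a2, a3, a4, a5⟩ := add1 c P h1 ht1
  have hd : p * σ * σ ∉ S ∪ cos A (p * σ) := by
    rintro (h | h)
    · exact h2 h
    · rw [mem_cos] at h
      apply c.σA
      have e : (p * σ)⁻¹ * (p * σ * σ) = σ := by group
      rwa [e] at h
  obtain ⟨fb, Pb, b1, b2, b3, b4, b5⟩ := add1 c Pa hd ht2
  have hp1 : p * σ ∈ cos A (p * σ) := self_cos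
  have hp2 : p * σ * σ ∈ cos A (p * σ * σ) := self_cos
  have q1 : ∀ x ∈ S, x ∉ cos A (p * σ) := fun x hx => not_mem_cos P.inv h1 hx
  have q2 : ∀ x ∈ S ∪ cos A (p * σ), x ∉ cos A (p * σ * σ) :=
    fun x hx => not_mem_cos Pa.inv hd hx
  obtain ⟨n1, n2, n3⟩ := c.ne3 p
  obtain ⟨Pt, e1, e2, e3, e4⟩ := triPart c Pb (p := p) (Or.inl (Or.inl hp)) (Or.inl (Or.inr hp1))
    (Or.inr hp2) (by rw [b1 p (Or.inl hp), a1 p hp, fp])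
    (by rw [b1 _ (Or.inr hp1), a2 _ hp1]
        have : (p * σ * t1⁻¹)⁻¹ * (p * σ) = t1 := by group
        rw [this, Ht1]; group)
    (by rw [b2 _ hp2]
        have : (p * σ * σ * t2⁻¹)⁻¹ * (p * σ * σ) = t2 := by group
        rw [this, Ht2]; group)
  have s1 : ¬ fb.SameCycle p (p * σ) := by
    rw [b3 _ (Or.inl hp) _ (Or.inr hp1)]
    exact fun h => h1 (a4 p hp _ h)
  have s2 : ¬ fb.SameCycle (p * σ) (p * σ * σ) := fun h => hd (b4 _ (Or.inr hp1) _ h)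
  have s3 : ¬ fb.SameCycle p (p * σ * σ) := fun h => hd (b4 _ (Or.inl hp) _ h)
  have T := tri_iff s1 s2 s3
  set F := fb * c3 p (p * σ) (p * σ * σ)
  have rp := SameCycle.refl fb p
  refine ⟨F, Pt, ?_, ?_, ?_, ?_, ?_, ?_⟩
  · intro x hx hxp
    rw [e4 x hxp (fun h => h1 (h ▸ hx)) (fun h => h2 (h ▸ hx)), b1 x (Or.inl hx), a1 x hx]
  · intro x hx hxp
    rw [e4 x (fun h => q1 _ (h ▸ hp) hx) hxp (fun h => q2 _ (Or.inr hx) (h ▸ hp2)),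
      b1 x (Or.inr hx), a2 x hx]
  · intro x hx hxp
    rw [e4 x (fun h => q2 _ (Or.inl (h ▸ hp)) hx) (fun h => q2 _ (Or.inr (h ▸ hp1)) hx) hxp,
      b2 x hx]
  · intro x hx y hy
    have k1 : ∀ z ∈ S, ¬ fb.SameCycle z (p * σ) := fun z hz h =>
      h1 (a4 z hz _ ((b3 _ (Or.inl hz) _ (Or.inr hp1)).1 h))
    have k2 : ∀ z ∈ S, ¬ fb.SameCycle z (p * σ * σ) := fun z hz h =>
      hd (b4 z (Or.inl hz) _ h)
    rw [T, b3 x (Or.inl hx) y (Or.inl hy), a3 x hx y hy]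
    constructor
    · rintro (h | ⟨h, h'⟩)
      · exact h
      · have hx' : fb.SameCycle x p := by
          rcases h with h | h | h
          exacts [h, absurd h (k1 x hx), absurd h (k2 x hx)]
        have hy' : fb.SameCycle y p := by
          rcases h' with h | h | h
          exacts [h, absurd h (k1 y hy), absurd h (k2 y hy)]
        have := hx'.trans hy'.symm
        rwa [b3 x (Or.inl hx) y (Or.inl hy), a3 x hx y hy] at this
    · exact Or.inl
  · intro x hx
    rw [T]
    refine Or.inr ⟨Or.inl rp, Or.inr (Or.inl ?_)⟩
    exact ((b3 _ (Or.inr hp1) _ (Or.inr hx)).2 (a5 x hx)).symm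
  · intro x hx
    rw [T]
    exact Or.inr ⟨Or.inl rp, Or.inr (Or.inr (b5 x hx).symm)⟩


def Avail (A0 : Subgroup G) (τ σ : G) (S : Set G) (f : Perm G) : Prop :=
  ∀ x ∈ S, (x * σ ∉ S ∨ x * σ * σ ∉ S) → ∃ a ∈ A0, f (x * a) = x * a * τ

lemma avail_gen (c : Ctx A A0 Gen τ τ' σ H) {S : Set G} {f : Perm G} (P : Part A Gen S f)
    {p : G} (h1 : p ∈ S) (h2 : p * σ ∈ S) (h3 : p * σ * σ ∈ S)
    (h : ∀ x ∈ S, (x * σ ∉ S ∨ x * σ * σ ∉ S) → ∃ a ∈ A0,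
      (x * a ≠ p → x * a ≠ p * σ → x * a ≠ p * σ * σ → f (x * a) = x * a * τ)) :
    Avail A0 τ σ S f := by
  intro x hx hh
  obtain ⟨a, ha, hf⟩ := h x hx hh
  refine ⟨a, ha, ?_⟩
  have cm : ∀ y, y * a⁻¹ * σ = y * σ * a⁻¹ := by
    intro y
    have := c.comm _ (A0.inv_mem ha)
    rw [mul_assoc, this, mul_assoc]
  have key : ∀ y, x * a = y → y * σ ∈ S → y * σ * σ ∈ S → False := by
    intro y hy k1 k2
    have hxy : x = y * a⁻¹ := by rw [← hy]; group
    have i := c.A0A (A0.inv_mem ha)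
    rcases hh with hh | hh
    · apply hh; rw [hxy, cm]; exact P.inv _ k1 _ i
    · apply hh; rw [hxy, cm, cm]; exact P.inv _ k2 _ i
  have e3 : p * σ * σ * σ = p := by
    have := c.hσ3
    calc p * σ * σ * σ = p * (σ * σ * σ) := by simp only [mul_assoc]
      _ = p := by rw [this, mul_one]
  refine hf (fun hy => key _ hy h2 h3) (fun hy => key _ hy h3 (by rwa [e3]))
    (fun hy => key _ hy (by rwa [e3]) (by rwa [e3]))

lemma place_avail (c : Ctx A A0 Gen τ τ' σ H) {q t x : G} (ht : t ∈ A) (hx : x ∈ cos A q) :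
    ∃ a ∈ A0, q * t⁻¹ * H ((q * t⁻¹)⁻¹ * (x * a)) = x * a * τ ∧ x * a ∈ cos A q := by
  have h : (q * t⁻¹)⁻¹ * x ∈ A := by
    have : (q * t⁻¹)⁻¹ * x = t * (q⁻¹ * x) := by group
    rw [this]; exact A.mul_mem ht hx
  obtain ⟨a, ha, hf⟩ := c.Hfull _ h
  refine ⟨a, ha, ?_, ?_⟩
  · rw [← mul_assoc, hf]; group
  · rw [mem_cos, ← mul_assoc]; exact A.mul_mem hx (c.A0A ha)

lemma attach' (c : Ctx A A0 Gen τ τ' σ H) {S : Set G} {f : Perm G} (P : Part A Gen S f)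
    (av : Avail A0 τ σ S f)
    {p t1 t2 : G} (hp : p ∈ S) (fp : f p = p * τ) (h1 : p * σ ∉ S) (h2 : p * σ * σ ∉ S)
    (ht1 : t1 ∈ A) (Ht1 : H t1 = t1 * τ) (ht2 : t2 ∈ A) (Ht2 : H t2 = t2 * τ) :
    ∃ f1, Part A Gen (S ∪ cos A (p * σ) ∪ cos A (p * σ * σ)) f1 ∧
      (∀ x ∈ S, x ≠ p → f1 x = f x) ∧
      (∀ x ∈ cos A (p * σ * σ), x ≠ p * σ * σ →
        f1 x = p * σ * σ * t2⁻¹ * H ((p * σ * σ * t2⁻¹)⁻¹ * x)) ∧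
      (∀ x ∈ S, ∀ y ∈ S, f1.SameCycle x y ↔ f.SameCycle x y) ∧
      (∀ x ∈ cos A (p * σ), f1.SameCycle p x) ∧
      (∀ x ∈ cos A (p * σ * σ), f1.SameCycle p x) ∧
      Avail A0 τ σ (S ∪ cos A (p * σ) ∪ cos A (p * σ * σ)) f1 := by
  obtain ⟨f1, P1, v1, v2, v3, r1, r2, r3⟩ := attach c P hp fp h1 h2 ht1 Ht1 ht2 Ht2
  refine ⟨f1, P1, v1, v3, r1, r2, r3, ?_⟩
  refine avail_gen c P1 (Or.inl (Or.inl hp)) (Or.inl (Or.inr self_cos)) (Or.inr self_cos) ?_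
  rintro x ((hx | hx) | hx) hh
  · obtain ⟨a, ha, hf⟩ := av x hx (hh.imp (fun h h' => h (Or.inl (Or.inl h')))
      (fun h h' => h (Or.inl (Or.inl h'))))
    exact ⟨a, ha, fun k1 _ _ => by rw [v1 _ (P.inv x hx a (c.A0A ha)) k1, hf]⟩
  · obtain ⟨a, ha, hf, hm⟩ := place_avail c ht1 hx
    exact ⟨a, ha, fun _ k2 _ => by rw [v2 _ hm k2, hf]⟩
  · obtain ⟨a, ha, hf, hm⟩ := place_avail c ht2 hx
    exact ⟨a, ha, fun _ _ k3 => by rw [v3 _ hm k3, hf]⟩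

structure State (A A0 : Subgroup G) (Gen : Set G) (τ τ' σ : G) (S : Set G) (f : Perm G) (u : G)
    (Q : Prop) : Prop where
  part : Part A Gen S f
  avail : Avail A0 τ σ S f
  hu : u ∈ S
  huσ : u * σ ∈ S
  fu : f u = u * τ'
  fuσ : f (u * σ) = u * σ * τ'
  cov : ∀ x ∈ S, f.SameCycle u x ∨ f.SameCycle (u * σ) x
  hQ : f.SameCycle u (u * σ) ↔ Q

lemma grow (c : Ctx A A0 Gen τ τ' σ H) {S : Set G} {f : Perm G} {u : G} {Q : Prop}
    (st : State A A0 Gen τ τ' σ S f u Q) {x : G} (hx : x ∈ S) (h1 : x * σ ∉ S)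
    (h2 : x * σ * σ ∉ S) :
    ∃ f', State A A0 Gen τ τ' σ (S ∪ cos A (x * σ) ∪ cos A (x * σ * σ)) f' u Q := by
  obtain ⟨P, av, hu, huσ, fu, fuσ, cov, hQ⟩ := st
  obtain ⟨a, ha, hf⟩ := av x hx (Or.inl h1)
  have haA := c.A0A ha
  obtain ⟨t, ht, Ht⟩ := c.Hfull 1 A.one_mem
  rw [one_mul] at Ht
  have htA := c.A0A ht
  have cm : ∀ y, y * a * σ = y * σ * a := by
    intro y; rw [mul_assoc, c.comm a ha, mul_assoc]
  have ec : ∀ y, cos A (y * a) = cos A y := by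
    intro y
    ext z
    rw [mem_cos, mem_cos]
    have : (y * a)⁻¹ * z = a⁻¹ * (y⁻¹ * z) := by group
    rw [this, A.mul_mem_cancel_left (A.inv_mem haA)]
  have k1 : x * a * σ ∉ S := by
    rw [cm]; intro h; apply h1
    have := P.inv _ h _ (A.inv_mem haA)
    simpa using this
  have k2 : x * a * σ * σ ∉ S := by
    rw [cm, cm]; intro h; apply h2
    have := P.inv _ h _ (A.inv_mem haA)
    simpa using this
  obtain ⟨f1, P1, v1, -, r1, r2, r3, av1⟩ :=
    attach' c P av (P.inv x hx a haA) hf k1 k2 htA Ht htA Ht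
  rw [cm, cm, ec, ec] at P1 av1
  rw [cm, ec] at r2
  rw [cm, cm, ec] at r3
  have nu : u ≠ x * a := by
    intro h; rw [← h, fu] at hf; exact c.ne (mul_left_cancel hf).symm
  have nuσ : u * σ ≠ x * a := by
    intro h; rw [← h, fuσ] at hf; exact c.ne (mul_left_cancel hf).symm
  have cov1 : ∀ y ∈ S, f1.SameCycle u y ∨ f1.SameCycle (u * σ) y := by
    intro y hy
    rw [r1 u hu y hy, r1 _ huσ y hy]; exact cov y hy
  have hxa := cov1 _ (P.inv x hx a haA)
  refine ⟨f1, P1, av1, Or.inl (Or.inl hu), Or.inl (Or.inl huσ), ?_, ?_, ?_, ?_⟩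
  · rw [v1 u hu nu, fu]
  · rw [v1 _ huσ nuσ, fuσ]
  · rintro y ((hy | hy) | hy)
    · exact cov1 y hy
    · exact hxa.imp (fun h => h.trans (r2 y hy)) (fun h => h.trans (r2 y hy))
    · exact hxa.imp (fun h => h.trans (r3 y hy)) (fun h => h.trans (r3 y hy))
  · rw [r1 u hu _ huσ]; exact hQ

lemma loop (c : Ctx A A0 Gen τ τ' σ H) {r : G} (hr : r ∈ A) (H1 : H 1 = τ) (Hr : H r = r * τ)
    {f0 : Perm G} (P0 : Part A Gen A f0) (f01 : f0 1 = τ) (f0r : f0 r = r * τ)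
    (full0 : ∀ x ∈ A, ∃ a ∈ A0, f0 (x * a) = x * a * τ)
    (cov0 : ∀ x ∈ A, f0.SameCycle 1 x ∨ f0.SameCycle r x) (hr1 : r ≠ 1)
    {X : Type*} (pr : G → X) (hpr : ∀ x, ∀ a ∈ A, pr (x * a) = pr x)
    (rel : σ * σ * r * σ * σ * r⁻¹ * σ * σ * r = r * σ)
    (nd : [pr 1, pr σ, pr (σ * σ), pr (σ * σ * r * σ), pr (σ * σ * r * σ * σ),
      pr (σ * σ * r * σ * σ * r⁻¹ * σ), pr (σ * σ * r * σ * σ * r⁻¹ * σ * σ),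
      pr (r * σ * σ)].Nodup) :
    ∃ f, State A A0 Gen τ τ' σ ((((((((A : Set G) ∪ cos A σ) ∪ cos A (σ * σ)) ∪
      cos A (σ * σ * r * σ)) ∪ cos A (σ * σ * r * σ * σ)) ∪
      cos A (σ * σ * r * σ * σ * r⁻¹ * σ)) ∪ cos A (σ * σ * r * σ * σ * r⁻¹ * σ * σ)) ∪
      cos A (r * σ * σ)) f r (¬ f0.SameCycle 1 r) := by
  have hcos : ∀ {x q}, x ∈ cos A q → pr x = pr q := by
    intro x q h
    have := hpr q _ h
    rwa [mul_inv_cancel_left] at this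
  have hA : ∀ {x}, x ∈ (A : Set G) → pr x = pr 1 := by
    intro x h
    have := hpr 1 x h
    rwa [one_mul] at this
  simp only [List.nodup_cons, List.mem_cons, List.not_mem_nil, or_false, not_or,
    List.nodup_nil, and_true, not_false_eq_true] at nd
  obtain ⟨⟨n12, n13, n14, n15, n16, n17, n18⟩, ⟨n23, n24, n25, n26, n27, n28⟩,
    ⟨n34, n35, n36, n37, n38⟩, ⟨n45, n46, n47, n48⟩, ⟨n56, n57, n58⟩, ⟨n67, n68⟩, n78⟩ := nd
  have av0 : Avail A0 τ σ (A : Set G) f0 := fun x hx _ => full0 x hx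
  have HT1 : H 1 = 1 * τ := by rw [H1, one_mul]
  -- step 1
  obtain ⟨f1, P1, v1, w1, r1, a1, b1, av1⟩ := attach' c P0 av0 (p := 1) (t1 := 1) (t2 := 1)
    A.one_mem (by rw [f01, one_mul]) (by rw [one_mul]; exact c.σA)
    (by rw [one_mul]; exact c.σσA) A.one_mem HT1 A.one_mem HT1
  simp only [one_mul, inv_one, mul_one] at P1 av1 w1 a1 b1
  -- step 2
  have m2 : σ * σ * r ∈ cos A (σ * σ) := by rw [mem_cos, inv_mul_cancel_left]; exact hr
  have fp2 : f1 (σ * σ * r) = σ * σ * r * τ := by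
    rw [w1 _ m2 (fun h => hr1 (mul_eq_left.1 h)), inv_mul_cancel_left, Hr, mul_assoc (σ * σ)]
  obtain ⟨f2, P2, v2, w2, r2, a2, b2, av2⟩ := attach' c P1 av1 (p := σ * σ * r) (t1 := 1) (t2 := r)
    (Or.inr m2) fp2
    (by rintro ((h | h) | h)
        exacts [n14 (hA h).symm, n24 (hcos h).symm, n34 (hcos h).symm])
    (by rintro ((h | h) | h)
        exacts [n15 (hA h).symm, n25 (hcos h).symm, n35 (hcos h).symm])
    A.one_mem HT1 hr Hr
  -- step 3
  have m3 : σ * σ * r * σ * σ * r⁻¹ ∈ cos A (σ * σ * r * σ * σ) := by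
    rw [mem_cos, inv_mul_cancel_left]; exact A.inv_mem hr
  have fp3 : f2 (σ * σ * r * σ * σ * r⁻¹) = σ * σ * r * σ * σ * r⁻¹ * τ := by
    rw [w2 _ m3 (fun h => hr1 (inv_eq_one.1 (mul_eq_left.1 h))), inv_mul_cancel, H1]
  obtain ⟨f3, P3, v3, w3, r3, a3, b3, av3⟩ := attach' c P2 av2
    (p := σ * σ * r * σ * σ * r⁻¹) (t1 := 1) (t2 := 1)
    (Or.inr m3) fp3
    (by rintro ((((h | h) | h) | h) | h)
        exacts [n16 (hA h).symm, n26 (hcos h).symm, n36 (hcos h).symm, n46 (hcos h).symm,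
          n56 (hcos h).symm])
    (by rintro ((((h | h) | h) | h) | h)
        exacts [n17 (hA h).symm, n27 (hcos h).symm, n37 (hcos h).symm, n47 (hcos h).symm,
          n57 (hcos h).symm])
    A.one_mem HT1 A.one_mem HT1
  simp only [inv_one, mul_one] at w3
  -- step 4
  have hAr : r ∈ (A : Set G) := hr
  have hA1 : (1 : G) ∈ (A : Set G) := A.one_mem
  have i1 : ∀ {x}, x ∈ (A : Set G) → x ∈ (A : Set G) ∪ cos A σ ∪ cos A (σ * σ) :=
    fun h => Or.inl (Or.inl h)
  have i2 : ∀ {x}, x ∈ (A : Set G) ∪ cos A σ ∪ cos A (σ * σ) →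
    x ∈ (A : Set G) ∪ cos A σ ∪ cos A (σ * σ) ∪ cos A (σ * σ * r * σ) ∪
      cos A (σ * σ * r * σ * σ) := fun h => Or.inl (Or.inl h)
  have i3 : ∀ {x}, x ∈ (A : Set G) ∪ cos A σ ∪ cos A (σ * σ) ∪ cos A (σ * σ * r * σ) ∪
      cos A (σ * σ * r * σ * σ) → x ∈ (A : Set G) ∪ cos A σ ∪ cos A (σ * σ) ∪
      cos A (σ * σ * r * σ) ∪
      cos A (σ * σ * r * σ * σ) ∪
      cos A (σ * σ * r * σ * σ * r⁻¹ * σ) ∪ cos A (σ * σ * r * σ * σ * r⁻¹ * σ * σ) :=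
    fun h => Or.inl (Or.inl h)
  have f3r : f3 r = r * τ := by
    rw [v3 r (i2 (i1 hAr)), v2 r (i1 hAr), v1 r hAr hr1, f0r]
    · intro h; rw [h] at hAr; exact n13 ((hA hAr).symm.trans (hcos m2))
    · intro h; rw [h] at hAr; exact n15 ((hA hAr).symm.trans (hcos m3))
  have m4 : r * σ ∈ cos A (σ * σ * r * σ * σ * r⁻¹ * σ * σ) := by
    rw [← rel, mem_cos, inv_mul_cancel_left]; exact hr
  have f3rσ : f3 (r * σ) = r * σ * τ := by
    rw [w3 _ m4, ← rel, inv_mul_cancel_left, Hr, mul_assoc (σ * σ * r * σ * σ * r⁻¹ * σ * σ)]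
    rw [← rel]
    exact fun h => hr1 (mul_eq_left.1 h)
  have hq4 : r * σ * σ ∉ (A : Set G) ∪ cos A σ ∪ cos A (σ * σ) ∪
      cos A (σ * σ * r * σ) ∪
      cos A (σ * σ * r * σ * σ) ∪
      cos A (σ * σ * r * σ * σ * r⁻¹ * σ) ∪ cos A (σ * σ * r * σ * σ * r⁻¹ * σ * σ) := by
    rintro ((((((h | h) | h) | h) | h) | h) | h)
    exacts [n18 (hA h).symm, n28 (hcos h).symm, n38 (hcos h).symm, n48 (hcos h).symm,
          n58 (hcos h).symm, n68 (hcos h).symm, n78 (hcos h).symm]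
  obtain ⟨f4, P4, v4, w4, r4, s4, t4⟩ := add1 c P3 (t := 1) hq4 A.one_mem
  simp only [inv_one, mul_one] at w4
  have hrS := i3 (i2 (i1 hAr))
  have h1S := i3 (i2 (i1 hA1))
  have hrσS : r * σ ∈ (A : Set G) ∪ cos A σ ∪ cos A (σ * σ) ∪
      cos A (σ * σ * r * σ) ∪
      cos A (σ * σ * r * σ * σ) ∪
      cos A (σ * σ * r * σ * σ * r⁻¹ * σ) ∪ cos A (σ * σ * r * σ * σ * r⁻¹ * σ * σ) := Or.inr m4
  -- cycles in f3
  have z1 : f3.SameCycle 1 (σ * σ * r) := by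
    rw [r3 _ (i2 (i1 hA1)) _ (i2 (Or.inr m2)), r2 _ (i1 hA1) _ (Or.inr m2)]
    exact b1 _ m2
  have z2 : f3.SameCycle 1 (σ * σ * r * σ * σ * r⁻¹) := by
    refine z1.trans ?_
    rw [r3 _ (i2 (Or.inr m2)) _ (Or.inr m3)]
    exact b2 _ m3
  have z3 : f3.SameCycle 1 (r * σ) := z2.trans (b3 _ m4)
  have z0 : f3.SameCycle 1 r ↔ f0.SameCycle 1 r := by
    rw [r3 _ (i2 (i1 hA1)) _ (i2 (i1 hAr)), r2 _ (i1 hA1) _ (i1 hAr), r1 _ hA1 _ hAr]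
  have zc : ∀ x ∈ (A : Set G) ∪ cos A σ ∪ cos A (σ * σ) ∪
      cos A (σ * σ * r * σ) ∪
      cos A (σ * σ * r * σ * σ) ∪
      cos A (σ * σ * r * σ * σ * r⁻¹ * σ) ∪ cos A (σ * σ * r * σ * σ * r⁻¹ * σ * σ),
      f3.SameCycle 1 x ∨ f3.SameCycle r x := by
    rintro x ((((((h | h) | h) | h) | h) | h) | h)
    · rw [r3 _ (i2 (i1 hA1)) _ (i2 (i1 h)), r2 _ (i1 hA1) _ (i1 h), r1 _ hA1 _ h,
        r3 _ (i2 (i1 hAr)) _ (i2 (i1 h)), r2 _ (i1 hAr) _ (i1 h), r1 _ hAr _ h]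
      exact cov0 x h
    · left
      rw [r3 _ (i2 (i1 hA1)) _ (i2 (Or.inl (Or.inr h))), r2 _ (i1 hA1) _ (Or.inl (Or.inr h))]
      exact a1 x h
    · left
      rw [r3 _ (i2 (i1 hA1)) _ (i2 (Or.inr h)), r2 _ (i1 hA1) _ (Or.inr h)]
      exact b1 x h
    · left; refine z1.trans ?_
      rw [r3 _ (i2 (Or.inr m2)) _ (Or.inl (Or.inr h))]
      exact a2 x h
    · left; refine z1.trans ?_
      rw [r3 _ (i2 (Or.inr m2)) _ (Or.inr h)]
      exact b2 x h
    · left; exact z2.trans (a3 x h)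
    · left; exact z2.trans (b3 x h)
  have hself : r * σ * σ ∈ cos A (r * σ * σ) := self_cos
  obtain ⟨Pt, e1, e2, e3, e4⟩ := triPart c P4 (p := r) (Or.inl hrS) (Or.inl hrσS) (Or.inr hself)
    (by rw [v4 _ hrS, f3r]) (by rw [v4 _ hrσS, f3rσ])
    (by rw [w4 _ hself, inv_mul_cancel, H1])
  obtain ⟨ne1, ne2, ne3⟩ := c.ne3 r
  obtain ⟨L1, L2⟩ := tri_last (f := f4) (p := r) (q := r * σ) (e := r * σ * σ) ne1
    (fun h => hq4 (s4 _ hrσS _ h)) (fun h => hq4 (s4 _ hrS _ h))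
  refine ⟨f4 * c3 r (r * σ) (r * σ * σ), Pt, ?_, Or.inl hrS, Or.inl hrσS, e1, e2, ?_, ?_⟩
  · refine avail_gen c Pt (Or.inl hrS) (Or.inl hrσS) (Or.inr hself) ?_
    rintro x (hx | hx) hh
    · obtain ⟨a, ha, hf⟩ := av3 x hx (hh.imp (fun h h' => h (Or.inl h'))
        (fun h h' => h (Or.inl h')))
      exact ⟨a, ha, fun k1 k2 k3 => by
        rw [e4 _ k1 k2 k3, v4 _ (P3.inv x hx a (c.A0A ha)), hf]⟩
    · obtain ⟨a, ha, hf, hm⟩ := place_avail c A.one_mem hx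
      simp only [inv_one, mul_one] at hf
      exact ⟨a, ha, fun k1 k2 k3 => by rw [e4 _ k1 k2 k3, w4 _ hm, hf]⟩
  · intro x hx
    apply L2
    rcases hx with hx | hx
    · rw [r4 _ hrS _ hx, r4 _ hrσS _ hx]
      rcases zc x hx with h | h
      · exact Or.inr (Or.inl (z3.symm.trans h))
      · exact Or.inl h
    · exact Or.inr (Or.inr (t4 x hx))
  · rw [L1, r4 _ hrS _ hrσS, ← z0]
    exact not_congr ⟨fun h => z3.trans h.symm, fun h => h.symm.trans z3⟩

end abstract
section concrete

lemma tau_val {N k : ℕ} (h1 : 1 ≤ k) (h2 : k ≤ N) (i : Fin N) :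
    (tau N k i).val = if i.val = 0 then k - 1 else if i.val < k then i.val - 1 else i.val := by
  have hk : k - 1 < N := by omega
  have hc : (if i.val = 0 then k - 1 else if i.val < k then i.val - 1 else i.val) < N := by
    have := i.isLt
    split_ifs <;> omega
  have : tau N k i = ⟨_, hc⟩ := by
    unfold tau
    rw [dif_pos hk, Perm.inv_eq_iff_eq]
    have : NeZero N := ⟨by omega⟩
    apply Fin.ext
    split_ifs with a b
    · rw [Fin.cycleRange_of_eq rfl]; simpa using a
    · rw [Fin.coe_cycleRange_of_lt]
      · simp; omega
      · simp [Fin.lt_def]; omega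
    · rw [Fin.cycleRange_of_gt]
      simp [Fin.lt_def]; omega
  rw [this]

lemma tau_sign {N k : ℕ} (hk : Odd k) (h2 : k ≤ N) : sign (tau N k) = 1 := by
  have h1 : 1 ≤ k := hk.pos
  unfold tau
  rw [dif_pos (by omega), Perm.sign_inv]
  have : NeZero N := ⟨by omega⟩
  rw [Fin.sign_cycleRange]
  simp only
  exact Even.neg_one_pow (Nat.Odd.sub_odd hk odd_one)

def sg (N m : ℕ) : Perm (Fin N) := tau N (m+2) * (tau N m)⁻¹

lemma sg_val {N m : ℕ} (h1 : 1 ≤ m) (h2 : m + 2 ≤ N) (i : Fin N) :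
    (sg N m i).val = if i.val + 1 = m then m + 1 else if i.val = m then m - 1 else
      if i.val = m + 1 then m else i.val := by
  obtain ⟨j, rfl⟩ := (tau N m).surjective i
  have a := tau_val (by omega) (by omega : m ≤ N) j
  have b := tau_val (by omega) h2 j
  have : sg N m (tau N m j) = tau N (m+2) j := by simp [sg]
  rw [this, b, a]
  split_ifs <;> omega

lemma sg_sign {N m : ℕ} (hm : Odd m) (h2 : m + 2 ≤ N) : sign (sg N m) = 1 := by
  unfold sg
  rw [Perm.sign_mul, Perm.sign_inv, tau_sign hm (by omega), tau_sign (by simpa [parity_simps] using hm) h2]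
  simp

def AA (N m : ℕ) : Subgroup (Perm (Fin N)) where
  carrier := {π | sign π = 1 ∧ ∀ i : Fin N, m ≤ i.val → π i = i}
  mul_mem' := by
    rintro a b ⟨ha, ha'⟩ ⟨hb, hb'⟩
    refine ⟨by rw [Perm.sign_mul, ha, hb, one_mul], fun i hi => by rw [Perm.mul_apply, hb' i hi, ha' i hi]⟩
  one_mem' := ⟨by simp, fun i _ => rfl⟩
  inv_mem' := by
    rintro a ⟨ha, ha'⟩
    exact ⟨by rw [Perm.sign_inv, ha], fun i hi => by rw [Perm.inv_eq_iff_eq, ha' i hi]⟩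

lemma mem_AA {N m : ℕ} {π : Perm (Fin N)} :
    π ∈ AA N m ↔ sign π = 1 ∧ ∀ i : Fin N, m ≤ i.val → π i = i := Iff.rfl

lemma AA_lt {N m : ℕ} {π : Perm (Fin N)} (h : π ∈ AA N m) {i : Fin N} (hi : i.val < m) :
    (π i).val < m := by
  by_contra hc
  have := h.2 (π i) (by omega)
  rw [π.injective this] at hc
  exact hc hi

lemma AA_mono {N m k : ℕ} (h : m ≤ k) : AA N m ≤ AA N k :=
  fun _ hx => ⟨hx.1, fun i hi => hx.2 i (by omega)⟩

lemma tau_mem {N k : ℕ} (hk : Odd k) (h2 : k ≤ N) : tau N k ∈ AA N k := by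
  refine ⟨tau_sign hk h2, fun i hi => ?_⟩
  apply Fin.ext
  rw [tau_val hk.pos h2]
  have := hk.pos
  split_ifs <;> omega

lemma sg_mem {N m : ℕ} (hm : Odd m) (h2 : m + 2 ≤ N) : sg N m ∈ AA N (m+2) := by
  refine ⟨sg_sign hm h2, fun i hi => ?_⟩
  apply Fin.ext
  rw [sg_val hm.pos h2]
  split_ifs <;> omega

def Gn (N m : ℕ) : Set (Perm (Fin N)) := {t | ∃ k, Odd k ∧ 3 ≤ k ∧ k ≤ m ∧ t = tau N k}

structure Good (N m : ℕ) (f : Perm (Perm (Fin N))) : Prop where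
  part : Part (AA N m) (Gn N m) (AA N m) f
  f1 : f 1 = tau N m
  fr : f (sg N (m-2)) = sg N (m-2) * tau N m
  cov : ∀ x ∈ AA N m, f.SameCycle 1 x ∨ f.SameCycle (sg N (m-2)) x

lemma Good.full {N m : ℕ} {f : Perm (Perm (Fin N))} (h : Good N m f) (hm : Odd m) (h5 : 5 ≤ m)
    (hN : m ≤ N) :
    ∀ x ∈ AA N m, ∃ a ∈ AA N (m-1), f (x * a) = x * a * tau N m := by
  intro x hx
  by_contra! hc
  have hcl : ∀ y ∈ {y | x⁻¹ * y ∈ AA N (m-1)}, f y ∈ {y | x⁻¹ * y ∈ AA N (m-1)} := by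
    intro y hy
    have hy' : x⁻¹ * y ∈ AA N (m-1) := hy
    have hyA : y ∈ AA N m := by
      have := (AA N m).mul_mem hx (AA_mono (by omega) hy')
      simpa using this
    obtain ⟨t, ⟨k, hk, hk3, hkm, rfl⟩, hf⟩ := h.part.gen y hyA
    have hne : k ≠ m := by
      rintro rfl
      have := hc _ hy'
      rw [mul_inv_cancel_left] at this
      exact this hf
    have hk2 : k ≤ m - 1 := by omega
    show x⁻¹ * f y ∈ AA N (m-1)
    rw [hf, ← mul_assoc]
    exact (AA N (m-1)).mul_mem hy' (AA_mono hk2 (tau_mem hk (by omega)))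
  have hxU : x ∈ {y | x⁻¹ * y ∈ AA N (m-1)} := by
    show x⁻¹ * x ∈ AA N (m-1)
    rw [inv_mul_cancel]; exact Subgroup.one_mem _
  rcases h.cov x hx with h' | h'
  · have h1 : x⁻¹ * 1 ∈ AA N (m-1) := sc_closed _ hcl h'.symm hxU
    have := hc _ h1
    rw [mul_inv_cancel_left, h.f1, one_mul] at this
    exact this rfl
  · have h1 : x⁻¹ * sg N (m-2) ∈ AA N (m-1) := sc_closed _ hcl h'.symm hxU
    have := hc _ h1
    rw [mul_inv_cancel_left] at this
    exact this h.fr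

lemma sg_comm {N m : ℕ} (hm : 1 ≤ m) (h2 : m + 2 ≤ N) {a : Perm (Fin N)} (ha : a ∈ AA N (m-1)) :
    a * sg N m = sg N m * a := by
  ext i
  rw [Perm.mul_apply, Perm.mul_apply]
  by_cases hi : i.val + 1 < m
  · have h1 : sg N m i = i := by
      apply Fin.ext; rw [sg_val hm h2]; split_ifs <;> omega
    have h3 := AA_lt ha (i := i) (by omega)
    rw [h1]
    rw [sg_val hm h2]
    split_ifs <;> omega
  · rw [ha.2 i (by omega)]
    rw [ha.2]
    rw [sg_val hm h2]
    split_ifs <;> omega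

lemma sg_cube {N m : ℕ} (hm : 1 ≤ m) (h2 : m + 2 ≤ N) : sg N m * sg N m * sg N m = 1 := by
  ext i
  simp only [Perm.mul_apply, Perm.one_apply, sg_val hm h2]
  split_ifs <;> omega

lemma sg_inv {N m : ℕ} (hm : 1 ≤ m) (h2 : m + 2 ≤ N) : (sg N m)⁻¹ = sg N m * sg N m := by
  rw [inv_eq_iff_mul_eq_one, ← mul_assoc, sg_cube hm h2]

lemma sg_rel {N j : ℕ} (hj : j + 5 ≤ N) :
    sg N (j+3) * sg N (j+3) * sg N (j+1) * sg N (j+3) * sg N (j+3) * (sg N (j+1))⁻¹ *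
      sg N (j+3) * sg N (j+3) * sg N (j+1) = sg N (j+1) * sg N (j+3) := by
  rw [sg_inv (by omega) (by omega)]
  ext i
  simp only [Perm.mul_apply]
  have v1 : ∀ i, (sg N (j+3) i).val = if i.val = j+2 then j+4 else if i.val = j+3 then j+2 else
      if i.val = j+4 then j+3 else i.val := by
    intro i; rw [sg_val (by omega) (by omega)]; split_ifs <;> omega
  have v2 : ∀ i, (sg N (j+1) i).val = if i.val = j then j+2 else if i.val = j+1 then j else
      if i.val = j+2 then j+1 else i.val := by
    intro i; rw [sg_val (by omega) (by omega)]; split_ifs <;> omega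
  have e1 : j + 4 ≠ j := by omega
  have e2 : j + 3 ≠ j := by omega
  have e3 : j + 2 ≠ j := by omega
  have e4 : j + 1 ≠ j := by omega
  simp only [v1, v2]
  by_cases h0 : i.val = j
  · simp [h0]
  by_cases h1 : i.val = j + 1
  · simp [h1]
  by_cases h2 : i.val = j + 2
  · simp [h2]
  by_cases h3 : i.val = j + 3
  · simp [h3]
  by_cases h4 : i.val = j + 4
  · simp [h4]
  simp [h0, h1, h2, h3, h4]

end concrete
section levelup

lemma Part.mono {G : Type*} [Group G] {A : Subgroup G} {Gen Gen' S : Set G} {f : Perm G}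
    (P : Part A Gen S f) (h : Gen ⊆ Gen') : Part A Gen' S f :=
  ⟨P.inv, P.fix, fun x hx => by obtain ⟨t, ht, e⟩ := P.gen x hx; exact ⟨t, h ht, e⟩⟩

lemma Gn_mono {N m k : ℕ} (h : m ≤ k) : Gn N m ⊆ Gn N k := by
  rintro t ⟨i, h1, h2, h3, h4⟩
  exact ⟨i, h1, h2, h3.trans h, h4⟩

lemma mkCtx {N m : ℕ} (hm : Odd m) (h5 : 5 ≤ m) (hN : m + 2 ≤ N) {H : Perm (Perm (Fin N))}
    (hH : Good N m H) (hc : H.SameCycle 1 (sg N (m-2))) :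
    Ctx (AA N m) (AA N (m-1)) (Gn N (m+2)) (tau N m) (tau N (m+2)) (sg N m) H where
  hσ := by simp [sg]
  hσ3 := sg_cube (by omega) hN
  σA := by
    intro h
    have h1 := h.2 ⟨m, by omega⟩ le_rfl
    have h2 := sg_val (N := N) (m := m) (by omega) hN ⟨m, by omega⟩
    rw [h1] at h2
    simp at h2
    omega
  hτ' := ⟨m+2, by simpa [parity_simps] using hm, by omega, le_rfl, rfl⟩
  A0A := AA_mono (by omega)
  comm := fun a ha => sg_comm (by omega) hN ha
  HP := hH.part.mono (Gn_mono (by omega))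
  Hc := fun x hx => by
    rcases hH.cov x hx with h | h
    · exact h
    · exact hc.trans h
  Hfull := hH.full hm h5 (by omega)

def pr {N m : ℕ} (h : m + 2 ≤ N) (π : Perm (Fin N)) : ℕ × ℕ :=
  ((π ⟨m, by omega⟩).val, (π ⟨m+1, by omega⟩).val)

lemma pr_mul {N m : ℕ} (h : m + 2 ≤ N) (x a : Perm (Fin N)) (ha : a ∈ AA N m) :
    pr h (x * a) = pr h x := by
  simp only [pr, Perm.mul_apply]
  rw [ha.2 ⟨m, by omega⟩ le_rfl, ha.2 ⟨m+1, by omega⟩ (Nat.le_succ m)]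

lemma cos_iff {N m : ℕ} (h : m + 2 ≤ N) {q x : Perm (Fin N)} (hq : q ∈ AA N (m+2)) :
    x ∈ cos (AA N m) q ↔ x ∈ AA N (m+2) ∧ pr h x = pr h q := by
  constructor
  · intro hx
    have e : x = q * (q⁻¹ * x) := by group
    refine ⟨?_, ?_⟩
    · rw [e]; exact (AA N (m+2)).mul_mem hq (AA_mono (by omega) hx)
    · conv_lhs => rw [e]
      exact pr_mul h q _ hx
  · rintro ⟨hx, he⟩
    have hz := (AA N (m+2)).mul_mem ((AA N (m+2)).inv_mem hq) hx
    refine ⟨hz.1, fun i hi => ?_⟩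
    by_cases h2 : m + 2 ≤ i.val
    · exact hz.2 i h2
    · simp only [pr, Prod.mk.injEq, Fin.val_inj] at he
      rw [Perm.mul_apply, Perm.inv_eq_iff_eq]
      have : i = ⟨m, by omega⟩ ∨ i = ⟨m+1, by omega⟩ := by
        rcases Nat.lt_or_ge i.val (m+1) with h3 | h3
        · left; apply Fin.ext; simp; omega
        · right; apply Fin.ext; simp; omega
      rcases this with e | e
      · rw [e]; exact he.1
      · rw [e]; exact he.2

lemma loop_pr {N j : ℕ} (h : j + 3 + 2 ≤ N) :
    pr h 1 = (j+3, j+4) ∧ pr h (sg N (j+3)) = (j+2, j+3) ∧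
    pr h (sg N (j+3) * sg N (j+3)) = (j+4, j+2) ∧
    pr h (sg N (j+3) * sg N (j+3) * sg N (j+1) * sg N (j+3)) = (j+1, j+4) ∧
    pr h (sg N (j+3) * sg N (j+3) * sg N (j+1) * sg N (j+3) * sg N (j+3)) = (j+2, j+1) ∧
    pr h (sg N (j+3) * sg N (j+3) * sg N (j+1) * sg N (j+3) * sg N (j+3) * (sg N (j+1))⁻¹ * sg N (j+3)) = (j+3, j+2) ∧
    pr h (sg N (j+3) * sg N (j+3) * sg N (j+1) * sg N (j+3) * sg N (j+3) * (sg N (j+1))⁻¹ * sg N (j+3) * sg N (j+3)) = (j+1, j+3) ∧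
    pr h (sg N (j+1) * sg N (j+3) * sg N (j+3)) = (j+4, j+1) := by
  rw [sg_inv (by omega) (by omega)]
  simp only [Perm.mul_apply, pr]
  have v1 : ∀ i, (sg N (j+3) i).val = if i.val = j+2 then j+4 else if i.val = j+3 then j+2 else
      if i.val = j+4 then j+3 else i.val := by
    intro i; rw [sg_val (by omega) (by omega)]; split_ifs <;> omega
  have v2 : ∀ i, (sg N (j+1) i).val = if i.val = j then j+2 else if i.val = j+1 then j else
      if i.val = j+2 then j+1 else i.val := by
    intro i; rw [sg_val (by omega) (by omega)]; split_ifs <;> omega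
  have e1 : j + 4 ≠ j := by omega
  have e2 : j + 3 ≠ j := by omega
  have e3 : j + 2 ≠ j := by omega
  have e4 : j + 1 ≠ j := by omega
  simp [v1, v2]

def W8 (j : ℕ) : Set (ℕ × ℕ) :=
  {(j+3, j+4), (j+2, j+3), (j+4, j+2), (j+1, j+4), (j+2, j+1), (j+3, j+2), (j+1, j+3), (j+4, j+1)}

def Reach {N m : ℕ} (h : m + 2 ≤ N) (Q : Prop) (P : Set (ℕ × ℕ)) : Prop :=
  ∃ f, State (AA N m) (AA N (m-1)) (Gn N (m+2)) (tau N m) (tau N (m+2)) (sg N m)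
    {π | π ∈ AA N (m+2) ∧ pr h π ∈ P} f (sg N (m-2)) Q

lemma reach0 {N j : ℕ} (hm : Odd (j+3)) (h5 : 2 ≤ j) (h : j + 3 + 2 ≤ N)
    {H f0 : Perm (Perm (Fin N))}
    (hH : Good N (j+3) H) (hc : H.SameCycle 1 (sg N (j+1))) (h0 : Good N (j+3) f0) :
    Reach h (¬ f0.SameCycle 1 (sg N (j+1))) (W8 j) := by
  have c := mkCtx hm (by omega) h hH hc
  have hm' : Odd (j+1) := by simpa [parity_simps] using hm
  have hr : sg N (j+1) ∈ AA N (j+3) := sg_mem hm' (by omega)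
  have hs : sg N (j+3) ∈ AA N (j+3+2) := sg_mem hm h
  have hr2 : sg N (j+1) ∈ AA N (j+3+2) := AA_mono (by omega) hr
  have hr1 : sg N (j+1) ≠ 1 := by
    intro h1
    have h2 := sg_val (N := N) (m := j+1) (by omega) (by omega) ⟨j, by omega⟩
    rw [h1] at h2
    simp at h2
    omega
  obtain ⟨p1, p2, p3, p4, p5, p6, p7, p8⟩ := loop_pr h
  obtain ⟨f, st⟩ := loop c hr hH.f1 hH.fr (h0.part.mono (Gn_mono (by omega))) h0.f1 h0.fr
    (h0.full hm (by omega) (by omega)) h0.cov hr1 (pr h) (pr_mul h) (sg_rel (by omega))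
    (by rw [p1, p2, p3, p4, p5, p6, p7, p8]; simp)
  refine ⟨f, ?_⟩
  convert st using 1
  have hA : ∀ x, x ∈ AA N (j+3) ↔ x ∈ AA N (j+3+2) ∧ pr h x = pr h 1 := by
    intro x
    rw [← cos_iff h (AA N (j+3+2)).one_mem]
    simp [cos]
  ext x
  have mm : ∀ {a b : Perm (Fin N)}, a ∈ AA N (j+3+2) → b ∈ AA N (j+3+2) → a * b ∈ AA N (j+3+2) :=
    fun ha hb => (AA N (j+3+2)).mul_mem ha hb
  have q3 := mm hs hs
  have q4 := mm (mm q3 hr2) hs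
  have q5 := mm q4 hs
  have q6 := mm (mm q5 ((AA N (j+3+2)).inv_mem hr2)) hs
  have q7 := mm q6 hs
  have q8 := mm (mm hr2 hs) hs
  simp only [Set.mem_union, SetLike.mem_coe, hA, cos_iff h hs, cos_iff h q3, cos_iff h q4,
    cos_iff h q5, cos_iff h q6, cos_iff h q7, cos_iff h q8, p1, p2, p3, p4, p5, p6, p7, p8, W8,
    Set.mem_ofPred_eq, Set.mem_insert_iff, Set.mem_singleton_iff, ← and_or_left, or_assoc]
  rfl

lemma pr_sg {N m : ℕ} (h : m + 2 ≤ N) (h1 : 1 ≤ m) (π : Perm (Fin N)) :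
    pr h (π * sg N m) = ((π ⟨m-1, by omega⟩).val, (π ⟨m, by omega⟩).val) := by
  have a : sg N m ⟨m, by omega⟩ = ⟨m-1, by omega⟩ := by
    apply Fin.ext; rw [sg_val h1 h]; simp
  have b : sg N m ⟨m+1, by omega⟩ = ⟨m, by omega⟩ := by
    apply Fin.ext; rw [sg_val h1 h]; simp; omega
  simp only [pr, Perm.mul_apply, a, b]

lemma pr_sg2 {N m : ℕ} (h : m + 2 ≤ N) (h1 : 1 ≤ m) (π : Perm (Fin N)) :
    pr h (π * sg N m * sg N m) = ((π ⟨m+1, by omega⟩).val, (π ⟨m-1, by omega⟩).val) := by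
  have a : sg N m ⟨m, by omega⟩ = ⟨m-1, by omega⟩ := by
    apply Fin.ext; rw [sg_val h1 h]; simp
  have b : sg N m ⟨m-1, by omega⟩ = ⟨m+1, by omega⟩ := by
    apply Fin.ext; rw [sg_val h1 h]; simp; omega
  rw [pr_sg h h1]
  simp only [Perm.mul_apply, a, b]

end levelup
section levelup2

lemma exists_perm {N m : ℕ} (h : m + 2 ≤ N) (h5 : 3 ≤ m) {x a b : Fin N} (hx : x.val < m+2)
    (ha : a.val < m+2) (hb : b.val < m+2) (xa : x ≠ a) (xb : x ≠ b) (ab : a ≠ b) :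
    ∃ π ∈ AA N (m+2), π ⟨m-1, by omega⟩ = x ∧ π ⟨m, by omega⟩ = a ∧ π ⟨m+1, by omega⟩ = b := by
  have key : ∃ π : Perm (Fin N), (∀ i : Fin N, m+2 ≤ i.val → π i = i) ∧
      π ⟨m-1, by omega⟩ = x ∧ π ⟨m, by omega⟩ = a ∧ π ⟨m+1, by omega⟩ = b := by
    have step : ∀ (π : Perm (Fin N)) (p y : Fin N), (∀ i : Fin N, m+2 ≤ i.val → π i = i) →
        p.val < m+2 → y.val < m+2 → ∃ π' : Perm (Fin N), (∀ i : Fin N, m+2 ≤ i.val → π' i = i) ∧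
          π' p = y ∧ ∀ i, i ≠ p → π i ≠ y → π' i = π i := by
      intro π p y hπ hp hy
      refine ⟨swap (π p) y * π, ?_, ?_, ?_⟩
      · intro i hi
        rw [Perm.mul_apply, hπ i hi, swap_apply_of_ne_of_ne]
        · intro e
          have : π i = π p := by rw [hπ i hi, e]
          have := π.injective this
          rw [this] at hi; omega
        · intro e; rw [e] at hi; omega
      · simp
      · intro i hi hy
        rw [Perm.mul_apply, swap_apply_of_ne_of_ne _ hy]
        exact fun e => hi (π.injective e)
    obtain ⟨π1, f1, v1, -⟩ := step 1 ⟨m+1, by omega⟩ b (fun _ _ => rfl) (by simp) hb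
    obtain ⟨π2, f2, v2, w2⟩ := step π1 ⟨m, by omega⟩ a f1 (by simp) ha
    obtain ⟨π3, f3, v3, w3⟩ := step π2 ⟨m-1, by omega⟩ x f2 (by simp; omega) hx
    have e2 : π2 ⟨m+1, by omega⟩ = b := by
      rw [w2 _ (by simp) (by rw [v1]; exact ab.symm), v1]
    refine ⟨π3, f3, v3, ?_, ?_⟩
    · rw [w3 _ (by simp [Fin.ext_iff]; omega) (by rw [v2]; exact xa.symm), v2]
    · rw [w3 _ (by simp [Fin.ext_iff]; omega) (by rw [e2]; exact xb.symm), e2]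
  obtain ⟨π, f, v1, v2, v3⟩ := key
  rcases Int.units_eq_one_or (sign π) with hs | hs
  · exact ⟨π, ⟨hs, f⟩, v1, v2, v3⟩
  · refine ⟨π * swap ⟨0, by omega⟩ ⟨1, by omega⟩, ⟨?_, ?_⟩, ?_, ?_, ?_⟩
    · rw [Perm.sign_mul, hs, sign_swap (by simp [Fin.ext_iff])]; simp
    · intro i hi
      rw [Perm.mul_apply, swap_apply_of_ne_of_ne, f i hi] <;> simp [Fin.ext_iff] <;> omega
    · rw [Perm.mul_apply, swap_apply_of_ne_of_ne, v1] <;> simp [Fin.ext_iff] <;> omega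
    · rw [Perm.mul_apply, swap_apply_of_ne_of_ne, v2] <;> simp [Fin.ext_iff] <;> omega
    · rw [Perm.mul_apply, swap_apply_of_ne_of_ne, v3] <;> simp [Fin.ext_iff] <;> omega

lemma reach_grow {N m : ℕ} (h : m + 2 ≤ N) (h5 : 5 ≤ m) (hm : Odd m) {H : Perm (Perm (Fin N))}
    (hH : Good N m H) (hc : H.SameCycle 1 (sg N (m-2))) {Q : Prop} {P : Set (ℕ × ℕ)}
    (R : Reach h Q P) {x a b : ℕ} (hx : x < m+2) (ha : a < m+2) (hb : b < m+2)
    (xa : x ≠ a) (xb : x ≠ b) (ab : a ≠ b) (h1 : (a, b) ∈ P) (h2 : (x, a) ∉ P) (h3 : (b, x) ∉ P) :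
    Reach h Q (P ∪ {(x, a), (b, x)}) := by
  have c := mkCtx hm h5 h hH hc
  obtain ⟨f, st⟩ := R
  obtain ⟨π, hπ, v1, v2, v3⟩ := exists_perm h (by omega) (x := ⟨x, by omega⟩) (a := ⟨a, by omega⟩)
    (b := ⟨b, by omega⟩) hx ha hb (by simpa using xa) (by simpa using xb) (by simpa using ab)
  have q1 : pr h π = (a, b) := by simp [pr, v2, v3]
  have q2 : pr h (π * sg N m) = (x, a) := by rw [pr_sg h (by omega), v1, v2]
  have q3 : pr h (π * sg N m * sg N m) = (b, x) := by rw [pr_sg2 h (by omega), v1, v3]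
  obtain ⟨f', st'⟩ := grow c st (x := π) ⟨hπ, by rw [q1]; exact h1⟩
    (fun hh => h2 (by rw [← q2]; exact hh.2)) (fun hh => h3 (by rw [← q3]; exact hh.2))
  refine ⟨f', ?_⟩
  have m1 := (AA N (m+2)).mul_mem hπ (sg_mem hm h)
  have m2 := (AA N (m+2)).mul_mem m1 (sg_mem hm h)
  convert st' using 1
  ext y
  simp only [Set.mem_union, cos_iff h m1, cos_iff h m2, q2, q3, 
    Set.mem_ofPred_eq, Set.mem_insert_iff, Set.mem_singleton_iff, ← and_or_left, or_assoc]

def OD (V : Finset ℕ) : Set (ℕ × ℕ) := {p | p.1 ∈ V ∧ p.2 ∈ V ∧ p.1 ≠ p.2}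

lemma reach_add {N m : ℕ} (h : m + 2 ≤ N) (h5 : 5 ≤ m) (hm : Odd m) {H : Perm (Perm (Fin N))}
    (hH : Good N m H) (hc : H.SameCycle 1 (sg N (m-2))) {Q : Prop} {V : Finset ℕ}
    (hV : ∀ v ∈ V, v < m+2) (hnt : V.Nontrivial)
    (R : Reach h Q (OD V)) {p : ℕ} (hp : p < m+2) (hpV : p ∉ V) : Reach h Q (OD (insert p V)) := by
  obtain ⟨φ, hφ⟩ : ∃ φ : Perm ℕ, φ.IsCycleOn (V : Set ℕ) := by
    refine ⟨V.toList.formPerm, ?_⟩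
    have := V.nodup_toList.isCycleOn_formPerm
    convert this using 1
    ext x; simp
  have hne : ∀ z ∈ V, φ z ≠ z := fun z hz => hφ.apply_ne hnt hz
  have hmem : ∀ z, φ z ∈ V ↔ z ∈ V := fun z => by
    have := hφ.apply_mem_iff (x := z)
    simpa using this
  have key : ∀ U : Finset ℕ, U ⊆ V →
      Reach h Q (OD V ∪ {q | (q.1 = p ∧ q.2 ∈ U) ∨ (q.2 = p ∧ φ.symm q.1 ∈ U)}) := by
    intro U
    induction U using Finset.induction_on with
    | empty => intro _; convert R using 1; ext q; simp
    | insert z U hz ih =>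
      intro hU
      have hzV : z ∈ V := hU (Finset.mem_insert_self _ _)
      have hfV := (hmem z).2 hzV
      have R' := ih (fun y hy => hU (Finset.mem_insert_of_mem hy))
      have hpz : p ≠ z := fun e => hpV (e ▸ hzV)
      have hpf : p ≠ φ z := fun e => hpV (e ▸ hfV)
      have := reach_grow h h5 hm hH hc R' (x := p) (a := z) (b := φ z) hp (hV _ hzV) (hV _ hfV)
        hpz hpf (hne z hzV).symm
        (Or.inl ⟨hzV, hfV, (hne z hzV).symm⟩)
        (by rintro (hh | ⟨-, hh⟩ | ⟨hh, -⟩)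
            · exact hpV hh.1
            · exact hz hh
            · exact hpz hh.symm)
        (by rintro (hh | ⟨hh, -⟩ | ⟨-, hh⟩)
            · exact hpV hh.2.1
            · exact hpf hh.symm
            · simp only [Equiv.symm_apply_apply] at hh
              exact hz hh)
      convert this using 1
      ext ⟨q1, q2⟩
      simp only [Set.mem_union, Set.mem_ofPred_eq, Finset.mem_insert, Set.mem_insert_iff,
        Set.mem_singleton_iff, Prod.mk.injEq, Equiv.symm_apply_eq]
      tauto
  convert key V subset_rfl using 1
  ext ⟨q1, q2⟩
  have e : φ.symm q1 ∈ V ↔ q1 ∈ V := by rw [← hmem, Equiv.apply_symm_apply]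
  simp only [OD, Set.mem_union, Set.mem_ofPred_eq, Finset.mem_insert, e]
  constructor
  · rintro ⟨rfl | h1, rfl | h2, h3⟩
    · exact absurd rfl h3
    · tauto
    · tauto
    · tauto
  · rintro (⟨h1, h2, h3⟩ | ⟨rfl, h2⟩ | ⟨rfl, h2⟩)
    · tauto
    · exact ⟨Or.inl rfl, Or.inr h2, fun e => hpV (e ▸ h2)⟩
    · exact ⟨Or.inr h2, Or.inl rfl, fun e => hpV (e ▸ h2)⟩

lemma reach_full {N j : ℕ} (h : j + 3 + 2 ≤ N) (h5 : 2 ≤ j) (hm : Odd (j+3)) {H : Perm (Perm (Fin N))}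
    (hH : Good N (j+3) H) (hc : H.SameCycle 1 (sg N (j+1))) {Q : Prop}
    (R : Reach h Q (W8 j)) : Reach h Q (OD (Finset.range (j+5))) := by
  have R1 := reach_grow h (by omega) hm hH hc R (x := j+3) (a := j+1) (b := j+4) (by omega)
    (by omega) (by omega) (by omega) (by omega) (by omega) (by simp [W8]) (by simp [W8]) (by simp [W8])
  have R2 := reach_grow h (by omega) hm hH hc R1 (x := j+2) (a := j+4) (b := j+1) (by omega)
    (by omega) (by omega) (by omega) (by omega) (by omega) (by simp [W8]) (by simp [W8]) (by simp [W8])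
  have R3 : Reach h Q (OD {j+1, j+2, j+3, j+4}) := by
    convert R2 using 1
    ext ⟨a, b⟩
    simp only [OD, W8, Set.mem_union, Set.mem_ofPred_eq, Finset.mem_insert, Finset.mem_singleton,
      Set.mem_insert_iff, Set.mem_singleton_iff, Prod.mk.injEq]
    constructor
    · rintro ⟨rfl | rfl | rfl | rfl, rfl | rfl | rfl | rfl, h3⟩ <;> simp at h3 ⊢
    · rintro (((g | g | g | g | g | g | g | g) | g | g) | g | g) <;> obtain ⟨rfl, rfl⟩ := g <;> simp
  have key : ∀ U : Finset ℕ, U ⊆ Finset.range (j+5) → Reach h Q (OD ({j+1, j+2, j+3, j+4} ∪ U)) := by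
    intro U
    induction U using Finset.induction_on with
    | empty => intro _; simpa using R3
    | insert z U hz ih =>
      intro hU
      have hzV := Finset.mem_range.1 (hU (Finset.mem_insert_self _ _))
      have R' := ih (fun y hy => hU (Finset.mem_insert_of_mem hy))
      rw [Finset.union_insert]
      by_cases hzz : z ∈ ({j+1, j+2, j+3, j+4} ∪ U : Finset ℕ)
      · rw [Finset.insert_eq_of_mem hzz]; exact R'
      · refine reach_add h (by omega) hm hH hc ?_ ?_ R' (by omega) hzz
        · intro v hv
          simp only [Finset.mem_union, Finset.mem_insert, Finset.mem_singleton] at hv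
          rcases hv with hv | hv
          · omega
          · have := Finset.mem_range.1 (hU (Finset.mem_insert_of_mem hv)); omega
        · exact ⟨j+1, by simp, j+2, by simp, by simp⟩
  have := key _ subset_rfl
  rwa [Finset.union_eq_right.2] at this
  intro v hv
  simp only [Finset.mem_insert, Finset.mem_singleton] at hv
  rw [Finset.mem_range]; omega

lemma levelup {N j : ℕ} (hm : Odd (j+3)) (h5 : 2 ≤ j) (h : j + 3 + 2 ≤ N)
    {H f0 : Perm (Perm (Fin N))}
    (hH : Good N (j+3) H) (hc : H.SameCycle 1 (sg N (j+1))) (h0 : Good N (j+3) f0) :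
    ∃ f, Good N (j+5) f ∧ (f.SameCycle 1 (sg N (j+3)) ↔ ¬ f0.SameCycle 1 (sg N (j+1))) := by
  obtain ⟨f, st⟩ := reach_full h h5 hm hH hc (reach0 hm h5 h hH hc h0)
  have hm' : Odd (j+1) := by simpa [parity_simps] using hm
  have hS : {π | π ∈ AA N (j+3+2) ∧ pr h π ∈ OD (Finset.range (j+5))} = (AA N (j+5) : Set _) := by
    ext π
    constructor
    · exact fun hh => hh.1
    · intro hh
      refine ⟨hh, ?_, ?_, ?_⟩
      · exact Finset.mem_range.2 (AA_lt hh (by simp))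
      · exact Finset.mem_range.2 (AA_lt hh (by simp))
      · simp [pr, Fin.val_inj]
  rw [hS] at st
  obtain ⟨P, av, hu, huσ, fu, fuσ, cov, hQ⟩ := st
  set r := sg N (j+1) with hr
  have er : sg N (j+3-2) = r := rfl
  rw [er] at hu huσ fu fuσ cov hQ
  set F : Perm (Perm (Fin N)) := Equiv.mulLeft r⁻¹ * f * (Equiv.mulLeft r⁻¹)⁻¹ with hF
  have Fval : ∀ x, F x = r⁻¹ * f (r * x) := by
    intro x; simp [hF]
  have Fsc : ∀ x y, F.SameCycle x y ↔ f.SameCycle (r * x) (r * y) := by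
    intro x y
    rw [hF, Perm.sameCycle_conj]
    simp
  have hrA : r ∈ AA N (j+5) := hu
  refine ⟨F, ⟨⟨?_, ?_, ?_⟩, ?_, ?_, ?_⟩, ?_⟩
  · exact fun x hx a ha => (AA N (j+5)).mul_mem hx ha
  · intro x hx
    rw [Fval, P.fix]
    · group
    · intro hh; exact hx (((AA N (j+5)).mul_mem_cancel_left hrA).1 hh)
  · intro x hx
    obtain ⟨t, ht, e⟩ := P.gen (r * x) ((AA N (j+5)).mul_mem hrA hx)
    exact ⟨t, ht, by rw [Fval, e]; group⟩
  · rw [Fval, mul_one, fu]; group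
  · show F (sg N (j+3)) = sg N (j+3) * tau N (j+5)
    rw [Fval, fuσ]; group
  · intro x hx
    have := cov (r * x) ((AA N (j+5)).mul_mem hrA hx)
    rw [Fsc, Fsc, mul_one]
    exact this
  · rw [Fsc, mul_one]; exact hQ

lemma climb {N : ℕ} (base : ∃ H K, Good N 7 H ∧ Good N 7 K ∧ H.SameCycle 1 (sg N 5) ∧
      ¬ K.SameCycle 1 (sg N 5)) (t : ℕ) (ht : 2 * t + 7 ≤ N) :
    ∃ H K, Good N (2*t+7) H ∧ Good N (2*t+7) K ∧ H.SameCycle 1 (sg N (2*t+5)) ∧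
      ¬ K.SameCycle 1 (sg N (2*t+5)) := by
  induction t with
  | zero => exact base
  | succ t ih =>
    obtain ⟨H, K, gH, gK, sH, sK⟩ := ih (by omega)
    have hm : Odd (2*t+4+3) := ⟨t+3, by ring⟩
    obtain ⟨H', a1, a2⟩ := levelup (j := 2*t+4) hm (by omega) (by omega) gH sH gK
    obtain ⟨K', b1, b2⟩ := levelup (j := 2*t+4) hm (by omega) (by omega) gH sH gH
    refine ⟨H', K', a1, b1, a2.2 sK, fun hh => b2.1 hh sH⟩

end levelup2
section base

def force (m : ℕ) (f : ℕ → Bool) : Bool := Nat.rec (f 0) (fun k _ => f (k+1)) m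

lemma force_eq (m : ℕ) (f : ℕ → Bool) : force m f = f m := by
  cases m <;> rfl

def run (W : ℕ) (k : ℕ → ℕ → ℕ → ℕ → ℕ → ℕ → ℕ → ℕ → Bool) (n : ℕ) :
    ℕ → ℕ → ℕ → ℕ → ℕ → ℕ → ℕ → ℕ → Bool :=
  Nat.rec (fun a b c d e f g M => k a b c d e f g M)
    (fun n ih a b c d e f g M =>
      bif Nat.beq (M / 2 ^ (a + 8 * b + 64 * c + 512 * d + 4096 * e) % 2) 1 then false else
      force (M ||| 2 ^ (a + 8 * b + 64 * c + 512 * d + 4096 * e)) fun M' =>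
      bif Nat.beq (W / 3 ^ n % 3) 0 then ih c a b d e f g M' else
      bif Nat.beq (W / 3 ^ n % 3) 1 then ih e a b c d f g M' else
      ih g a b c d e f M') n

def end1 (a b c d e f g : ℕ) : Bool :=
  a.beq 0 && b.beq 1 && c.beq 2 && d.beq 3 && e.beq 4 && f.beq 5 && g.beq 6

def endr (a b c d e f g : ℕ) : Bool :=
  a.beq 0 && b.beq 1 && c.beq 2 && d.beq 3 && e.beq 6 && f.beq 4 && g.beq 5

def WH1 : ℕ := 2030877208064122625814343263283914372560325242189046122891741759845026638670665569690964311933093028552642662950981905978256122598522841498759971745331255159672936675810484077135403390624408126649487667378989069336493321221056055611245143904088435195861714603795857233583479221143724726684400679386563676243350437301610375211945086356513524071655967940913604408411276948163194170276740330429278062010533658238841550146202725133779785822512920248102183615474769604001243345014937744637480625017515216343075808461003904665939631976738501256024020574470317729681071590893792419996943459649394513203650054470068631515743622725767036510585393324046592569321167550786463489580058531862584504133378142123620663025413081147124889077018434557593055310853282694687026547512645854970485911975985333872279999634525959224668510907274545484872764386288934760087397089726430876395257634164287169732587843269669366670226255715285527296667132080755133603429779221740620960007593920513194253327327976431448029982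8319656111075926522265228451719
def WH2 : ℕ := 7783008403656059943513496005429034333368066117901713500536045171174738822618662000542708822325770797155005870678040092755837974721646360767006877867650355835360564300640670808166
def WK1 : ℕ := 154710799063401391289851181521056259306489190195414963291167659048062150699919955569997949439526228019086485484628612596299655669327859628403887525925070524676157425787219535209626341281677881940798367489024795641555134009535096781934509596756458744393616003914427881527041768407600675665115202389207788212331738844866170841726039751169874973267007975132834077552006471908302922525049589361632815421113382025253544789039464440749940880167574483398321164599807154097670184469804709005112172570701474892534277044395915352817267998102098732465525290085595245681960812289131865055950930765144018616448177773620314114471915117493433787088570652551208848125107825036338956384182609296306292032762964992898829341818915291253981449074771625144002620069212427635029115675545271358721637174919788576579129058079168251546561464552940059187281697573292879485666599091540227491190980897167787654914061408386014893872475285699146763881239914853638752414352413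
def WK2 : ℕ := 1185449524023115194900214282307958581918906898150422254909298275186548929173578833536726695662121569201309148960017435031939446572642235569392984487723862669921739302746035701132060163722894629830246002879102649582988233953142495066416121587879962193341167044

lemma chkH : run WH1 (fun a b c d e f g M => endr a b c d e f g &&
    run WH2 (fun a b c d e f g _ => end1 a b c d e f g) 373 0 1 2 3 6 4 5 M)
    2147 0 1 2 3 4 5 6 0 = true := by decide +kernel

lemma chkK : run WK1 (fun a b c d e f g M => end1 a b c d e f g &&
    run WK2 (fun a b c d e f g _ => endr a b c d e f g) 541 0 1 2 3 6 4 5 M)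
    1979 0 1 2 3 4 5 6 0 = true := by decide +kernel

end base
section base2
variable {N : ℕ}

def vv (N : ℕ) (π : Perm (Fin N)) (i : ℕ) : ℕ := if h : i < N then (π ⟨i, h⟩).val else 0

def code (N : ℕ) (π : Perm (Fin N)) : ℕ :=
  vv N π 0 + 8 * vv N π 1 + 64 * vv N π 2 + 512 * vv N π 3 + 4096 * vv N π 4

def dg (W n : ℕ) : ℕ := 2 * (W / 3 ^ n % 3) + 3

lemma dg_cases (W n : ℕ) : (W / 3 ^ n % 3 = 0 ∧ dg W n = 3) ∨ (W / 3 ^ n % 3 = 1 ∧ dg W n = 5) ∨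
    (W / 3 ^ n % 3 = 2 ∧ dg W n = 7) := by
  unfold dg; omega

def path (N W : ℕ) : ℕ → Perm (Fin N) → List (Perm (Fin N))
  | 0, _ => []
  | n+1, π => π :: path N W n (π * tau N (dg W n))

def fin (N W : ℕ) : ℕ → Perm (Fin N) → Perm (Fin N)
  | 0, π => π
  | n+1, π => fin N W n (π * tau N (dg W n))

def runv (N W : ℕ) (k : ℕ → ℕ → ℕ → ℕ → ℕ → ℕ → ℕ → ℕ → Bool) (n : ℕ) (π : Perm (Fin N)) (M : ℕ) : Bool :=
  run W k n (vv N π 0) (vv N π 1) (vv N π 2) (vv N π 3) (vv N π 4) (vv N π 5) (vv N π 6) M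

lemma vv_mul (hN : 7 ≤ N) (π : Perm (Fin N)) {k i : ℕ} (hk : 1 ≤ k) (hk7 : k ≤ 7) (hi : i < 7) :
    vv N (π * tau N k) i = vv N π (if i = 0 then k - 1 else if i < k then i - 1 else i) := by
  have h := tau_val (N := N) hk (by omega) ⟨i, by omega⟩
  simp only at h
  have hlt : (if i = 0 then k - 1 else if i < k then i - 1 else i) < N := by
    split_ifs <;> omega
  have : tau N k ⟨i, by omega⟩ = ⟨_, hlt⟩ := Fin.ext h
  unfold vv
  rw [dif_pos (by omega), dif_pos hlt, Perm.mul_apply, this]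

lemma runv_succ (hN : 7 ≤ N) (W : ℕ) (k) (n : ℕ) (π : Perm (Fin N)) (M : ℕ)
    (h : runv N W k (n+1) π M = true) :
    M.testBit (code N π) = false ∧
    runv N W k n (π * tau N (dg W n)) (M ||| 2 ^ code N π) = true := by
  have e : runv N W k (n+1) π M =
      bif Nat.beq (M / 2 ^ code N π % 2) 1 then false else
      force (M ||| 2 ^ code N π) fun M' =>
      bif Nat.beq (W / 3 ^ n % 3) 0 then run W k n (vv N π 2) (vv N π 0) (vv N π 1) (vv N π 3) (vv N π 4) (vv N π 5) (vv N π 6) M' else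
      bif Nat.beq (W / 3 ^ n % 3) 1 then run W k n (vv N π 4) (vv N π 0) (vv N π 1) (vv N π 2) (vv N π 3) (vv N π 5) (vv N π 6) M' else
      run W k n (vv N π 6) (vv N π 0) (vv N π 1) (vv N π 2) (vv N π 3) (vv N π 4) (vv N π 5) M' := rfl
  rw [e, force_eq] at h
  have hb : M.testBit (code N π) = false := by
    rw [Nat.testBit_eq_decide_div_mod_eq]
    by_contra hc
    simp only [decide_eq_false_iff_not, not_not] at hc
    rw [hc] at h
    simp at h
  refine ⟨hb, ?_⟩
  have hb' : Nat.beq (M / 2 ^ code N π % 2) 1 = false := by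
    rw [Nat.testBit_eq_decide_div_mod_eq] at hb
    simp at hb
    rw [hb]; rfl
  rw [hb', cond_false] at h
  unfold runv
  rcases dg_cases W n with ⟨a, b⟩ | ⟨a, b⟩ | ⟨a, b⟩ <;>
  · rw [a] at h
    rw [b]
    simp only [vv_mul hN π (show 1 ≤ 3 by omega) (show 3 ≤ 7 by omega), vv_mul hN π (show 1 ≤ 5 by omega) (show 5 ≤ 7 by omega), vv_mul hN π (show 1 ≤ 7 by omega) (show 7 ≤ 7 by omega), Nat.reduceLT]
    exact h

lemma runv_spec (hN : 7 ≤ N) (W : ℕ) (k) (n : ℕ) : ∀ (π : Perm (Fin N)) (M : ℕ)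
    (_ : runv N W k n π M = true),
    (path N W n π).Nodup ∧ (∀ x ∈ path N W n π, M.testBit (code N x) = false) ∧
    ∃ M', runv N W k 0 (fin N W n π) M' = true ∧ ∀ x, (M.testBit (code N x) = true ∨
      x ∈ path N W n π) → M'.testBit (code N x) = true := by
  induction n with
  | zero =>
    intro π M h
    exact ⟨List.nodup_nil, by simp [path], M, h, by simp [path]⟩
  | succ n ih =>
    intro π M h
    obtain ⟨h1, h2⟩ := runv_succ hN W k n π M h
    obtain ⟨a1, a2, M', a3, a4⟩ := ih _ _ h2
    have b2 : ∀ x ∈ path N W n (π * tau N (dg W n)), M.testBit (code N x) = false ∧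
        x ≠ π := by
      intro x hx
      have := a2 x hx
      rw [Nat.testBit_or, Bool.or_eq_false_iff] at this
      refine ⟨this.1, ?_⟩
      rintro rfl
      have := this.2
      rw [Nat.testBit_two_pow_self] at this
      exact absurd this (by simp)
    refine ⟨?_, ?_, M', a3, ?_⟩
    · rw [path, List.nodup_cons]
      exact ⟨fun hm => (b2 π hm).2 rfl, a1⟩
    · intro x hx
      rw [path, List.mem_cons] at hx
      rcases hx with rfl | hx
      · exact h1
      · exact (b2 x hx).1
    · intro x hx
      apply a4
      rw [path, List.mem_cons] at hx
      rw [Nat.testBit_or]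
      rcases hx with hx | rfl | hx
      · left; simp [hx]
      · left; simp [Nat.testBit_two_pow_self]
      · right; exact hx

lemma path_length (W n : ℕ) : ∀ π, (path N W n π).length = n := by
  induction n with
  | zero => intro π; rfl
  | succ n ih => intro π; simp [path, ih]

lemma dg_Gn (W n : ℕ) : tau N (dg W n) ∈ Gn N 7 := by
  rcases dg_cases W n with ⟨-, b⟩ | ⟨-, b⟩ | ⟨-, b⟩ <;> rw [b]
  · exact ⟨3, by decide, by omega, by omega, rfl⟩
  · exact ⟨5, by decide, by omega, by omega, rfl⟩
  · exact ⟨7, by decide, by omega, by omega, rfl⟩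

lemma Gn_AA (hN : 7 ≤ N) {t : Perm (Fin N)} (ht : t ∈ Gn N 7) : t ∈ AA N 7 := by
  obtain ⟨k, h1, h2, h3, rfl⟩ := ht
  exact AA_mono h3 (tau_mem h1 (by omega))

lemma path_mem (hN : 7 ≤ N) (W n : ℕ) : ∀ π ∈ AA N 7, ∀ x ∈ path N W n π, x ∈ AA N 7 := by
  induction n with
  | zero => intro π _ x hx; simp [path] at hx
  | succ n ih =>
    intro π hπ x hx
    rw [path, List.mem_cons] at hx
    rcases hx with rfl | hx
    · exact hπ
    · exact ih _ ((AA N 7).mul_mem hπ (Gn_AA hN (dg_Gn W n))) x hx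

lemma fin_mem (hN : 7 ≤ N) (W n : ℕ) : ∀ π ∈ AA N 7, fin N W n π ∈ AA N 7 := by
  induction n with
  | zero => intro π h; exact h
  | succ n ih =>
    intro π hπ
    exact ih _ ((AA N 7).mul_mem hπ (Gn_AA hN (dg_Gn W n)))

/-- follow relation -/
def Fol {G : Type*} (f : G → G) (l : List G) (e : G) : Prop := List.IsChain (fun x y => f x = y) (l ++ [e])

lemma fol_gen (f : Perm (Fin N) → Perm (Fin N)) (W n : ℕ) : ∀ π,
    Fol f (path N W n π) (fin N W n π) → ∀ x ∈ path N W n π, ∃ t ∈ Gn N 7, f x = x * t := by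
  induction n with
  | zero => intro π _ x hx; simp [path] at hx
  | succ n ih =>
    intro π h x hx
    rw [path, List.mem_cons] at hx
    unfold Fol at h
    rw [path, fin, List.cons_append] at h
    rcases hx with rfl | hx
    · refine ⟨_, dg_Gn W n, ?_⟩
      cases n with
      | zero => simpa [path, fin] using h
      | succ n =>
        rw [path, List.cons_append, List.isChain_cons_cons] at h
        exact h.1
    · exact ih _ (h.tail) x hx

lemma fol_head (f : Perm (Fin N) → Perm (Fin N)) (W n : ℕ) (π)
    (h : Fol f (path N W (n+1) π) (fin N W (n+1) π)) : f π = π * tau N (dg W n) := by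
  unfold Fol at h
  rw [path, fin, List.cons_append] at h
  cases n with
  | zero => simpa [path, fin] using h
  | succ n =>
    rw [path, List.cons_append, List.isChain_cons_cons] at h
    exact h.1

lemma fol_formPerm {G : Type*} [DecidableEq G] (x : G) (l : List G) (h : (x :: l).Nodup) :
    Fol ((x :: l).formPerm) (x :: l) x := by
  unfold Fol
  rw [List.isChain_iff_getElem]
  intro i hi
  have hi' : i < (x :: l).length := by simpa using hi
  have := List.formPerm_apply_getElem (x :: l) h i hi'
  rw [List.getElem_append_left hi', this]
  by_cases hl : i + 1 < (x :: l).length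
  · rw [List.getElem_append_left hl]
    congr 1
    exact Nat.mod_eq_of_lt hl
  · have e : i + 1 = (x :: l).length := by omega
    rw [List.getElem_append_right (by omega)]
    simp [e]

lemma card_AA (hN : 7 ≤ N) (T : Finset (Perm (Fin N))) (hT : ∀ x ∈ T, x ∈ AA N 7)
    (hc : T.card = 2520) : ∀ x ∈ AA N 7, x ∈ T := by
  classical
  let p : Fin N → Prop := fun i => i.val < 7
  have key : ∀ x ∈ AA N 7, ∀ i, p (x i) ↔ p i := by
    intro x hx i
    refine ⟨fun h => ?_, fun h => AA_lt hx h⟩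
    by_contra hc
    have := hx.2 i (by simpa [p] using hc)
    rw [this] at h; exact hc h
  let F : AA N 7 → alternatingGroup {i // p i} := fun x =>
    ⟨x.1.subtypePerm (key x.1 x.2), by
      rw [mem_alternatingGroup, sign_subtypePerm _ _ ?_]
      · exact x.2.1
      · intro i hi
        by_contra hc
        exact hi (x.2.2 i (by simpa [p] using hc))⟩
  have Finj : Function.Injective F := by
    rintro ⟨x, hx⟩ ⟨y, hy⟩ e
    have e' := congrArg Subtype.val e
    apply Subtype.ext
    ext i
    show (x i).val = (y i).val
    by_cases hi : p i
    · have := congrArg (fun f : Perm {i // p i} => (f ⟨i, hi⟩).1.val) e'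
      simpa [F] using this
    · have hi' : 7 ≤ i.val := by simpa [p] using hi
      rw [hx.2 i hi', hy.2 i hi']
  have hcard : Fintype.card {i // p i} = 7 := by
    have : Fintype.card {i // p i} = Fintype.card (Fin 7) := by
      refine Fintype.card_congr ⟨fun i => ⟨i.1.val, i.2⟩, fun i => ⟨⟨i.val, by omega⟩, i.isLt⟩, ?_, ?_⟩
      · intro i; rfl
      · intro i; rfl
    rw [this, Fintype.card_fin]
  have : Nontrivial {i // p i} := by
    rw [← Fintype.one_lt_card_iff_nontrivial, hcard]; omega
  have h1 := two_mul_card_alternatingGroup (α := {i // p i})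
  rw [Fintype.card_perm, hcard] at h1
  have h2 := Fintype.card_le_of_injective F Finj
  have h3 : Nat.factorial 7 = 5040 := by decide
  let U : Finset (Perm (Fin N)) := Finset.univ.filter (· ∈ AA N 7)
  have hU : U.card = Fintype.card (AA N 7) := by
    rw [Fintype.card_subtype]
  have hTU : T ⊆ U := fun x hx => by simp [U, hT x hx]
  have : T = U := Finset.eq_of_subset_of_card_le hTU (by omega)
  intro x hx
  rw [this]; simp [U, hx]

lemma vv_ext {x y : Perm (Fin N)} (hx : x ∈ AA N 7) (hy : y ∈ AA N 7)
    (h : ∀ i < 7, vv N x i = vv N y i) : x = y := by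
  ext i
  by_cases hi : i.val < 7
  · have := h i.val hi
    simpa [vv] using this
  · rw [hx.2 i (by omega), hy.2 i (by omega)]

lemma vv_one (hN : 7 ≤ N) {i : ℕ} (hi : i < 7) : vv N 1 i = i := by
  unfold vv; rw [dif_pos (by omega)]; rfl

lemma vv_r (hN : 7 ≤ N) {i : ℕ} (hi : i < 7) : vv N (sg N 5) i =
    if i = 4 then 6 else if i = 5 then 4 else if i = 6 then 5 else i := by
  unfold vv; rw [dif_pos (by omega), sg_val (by omega) (by omega)]
  simp

lemma end1_spec (hN : 7 ≤ N) {x : Perm (Fin N)} (hx : x ∈ AA N 7)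
    (h : end1 (vv N x 0) (vv N x 1) (vv N x 2) (vv N x 3) (vv N x 4) (vv N x 5) (vv N x 6) = true) :
    x = 1 := by
  apply vv_ext hx (AA N 7).one_mem
  simp only [end1, Bool.and_eq_true, Nat.beq_eq] at h
  intro i hi
  rw [vv_one hN hi]
  interval_cases i <;> omega

lemma endr_spec (hN : 7 ≤ N) {x : Perm (Fin N)} (hx : x ∈ AA N 7)
    (h : endr (vv N x 0) (vv N x 1) (vv N x 2) (vv N x 3) (vv N x 4) (vv N x 5) (vv N x 6) = true) :
    x = sg N 5 := by
  apply vv_ext hx (sg_mem (by decide) (by omega))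
  simp only [endr, Bool.and_eq_true, Nat.beq_eq] at h
  intro i hi
  rw [vv_r hN hi]
  interval_cases i <;> simp <;> omega

end base2
section base3
variable {N : ℕ}

lemma runv_one (hN : 7 ≤ N) (W : ℕ) (k) (n M : ℕ) :
    runv N W k n 1 M = run W k n 0 1 2 3 4 5 6 M := by
  unfold runv
  simp only [vv_one hN (show 0 < 7 by omega), vv_one hN (show 1 < 7 by omega),
    vv_one hN (show 2 < 7 by omega), vv_one hN (show 3 < 7 by omega),
    vv_one hN (show 4 < 7 by omega), vv_one hN (show 5 < 7 by omega), vv_one hN (show 6 < 7 by omega)]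

lemma runv_r (hN : 7 ≤ N) (W : ℕ) (k) (n M : ℕ) :
    runv N W k n (sg N 5) M = run W k n 0 1 2 3 6 4 5 M := by
  unfold runv
  simp only [vv_r hN (show 0 < 7 by omega), vv_r hN (show 1 < 7 by omega),
    vv_r hN (show 2 < 7 by omega), vv_r hN (show 3 < 7 by omega),
    vv_r hN (show 4 < 7 by omega), vv_r hN (show 5 < 7 by omega), vv_r hN (show 6 < 7 by omega)]
  rfl

lemma two_paths (hN : 7 ≤ N) (W1 W2 n1 n2 : ℕ) (E1 E2 : ℕ → ℕ → ℕ → ℕ → ℕ → ℕ → ℕ → Bool)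
    (e1 e2 : Perm (Fin N))
    (s1 : ∀ x ∈ AA N 7, E1 (vv N x 0) (vv N x 1) (vv N x 2) (vv N x 3) (vv N x 4) (vv N x 5) (vv N x 6) = true → x = e1)
    (s2 : ∀ x ∈ AA N 7, E2 (vv N x 0) (vv N x 1) (vv N x 2) (vv N x 3) (vv N x 4) (vv N x 5) (vv N x 6) = true → x = e2)
    (h : run W1 (fun a b c d e f g M => E1 a b c d e f g &&
      run W2 (fun a b c d e f g _ => E2 a b c d e f g) n2 0 1 2 3 6 4 5 M)
      n1 0 1 2 3 4 5 6 0 = true) :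
    (path N W1 n1 1 ++ path N W2 n2 (sg N 5)).Nodup ∧ fin N W1 n1 1 = e1 ∧
      fin N W2 n2 (sg N 5) = e2 := by
  rw [← runv_one hN] at h
  obtain ⟨a1, -, M, a3, a4⟩ := runv_spec hN _ _ _ _ _ h
  have a5 : (E1 _ _ _ _ _ _ _ && run W2 (fun a b c d e f g _ => E2 a b c d e f g) n2
    0 1 2 3 6 4 5 M) = true := a3
  rw [Bool.and_eq_true, ← runv_r hN] at a5
  obtain ⟨a6, a7⟩ := a5
  obtain ⟨b1, b2, M', b3, -⟩ := runv_spec hN _ _ _ _ _ a7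
  have hr : sg N 5 ∈ AA N 7 := sg_mem (by decide) (by omega)
  refine ⟨?_, s1 _ (fin_mem hN _ _ _ (AA N 7).one_mem) a6, s2 _ (fin_mem hN _ _ _ hr) b3⟩
  rw [List.nodup_append]
  refine ⟨a1, b1, ?_⟩
  rintro x hx y hy rfl
  have := a4 x (Or.inr hx)
  rw [b2 x hy] at this
  exact absurd this (by simp)

lemma paths_all (hN : 7 ≤ N) (W1 W2 n1 n2 : ℕ) (hn : n1 + n2 = 2520)
    (h : (path N W1 n1 1 ++ path N W2 n2 (sg N 5)).Nodup) :
    ∀ x, x ∈ AA N 7 ↔ x ∈ path N W1 n1 1 ++ path N W2 n2 (sg N 5) := by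
  have hr : sg N 5 ∈ AA N 7 := sg_mem (by decide) (by omega)
  have h1 : ∀ x, x ∈ path N W1 n1 1 ++ path N W2 n2 (sg N 5) → x ∈ AA N 7 := by
    intro x hx
    rw [List.mem_append] at hx
    rcases hx with hx | hx
    · exact path_mem hN _ _ _ (AA N 7).one_mem x hx
    · exact path_mem hN _ _ _ hr x hx
  intro x
  refine ⟨fun hx => ?_, h1 x⟩
  have := card_AA hN (path N W1 n1 1 ++ path N W2 n2 (sg N 5)).toFinset
    (fun x hx => h1 x (List.mem_toFinset.1 hx))
    (by rw [List.toFinset_card_of_nodup h, List.length_append, path_length, path_length, hn]) x hx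
  exact List.mem_toFinset.1 this

lemma fol_append {G : Type*} (f : G → G) (x y : G) (l1 l2 : List G) (e : G)
    (h : Fol f (x :: l1 ++ y :: l2) e) : Fol f (x :: l1) y ∧ Fol f (y :: l2) e := by
  unfold Fol at *
  rw [List.append_assoc, List.cons_append (a := y)] at h
  have h2 : x :: l1 ++ y :: (l2 ++ [e]) = (x :: l1 ++ [y]) ++ (l2 ++ [e]) := by simp
  refine ⟨?_, ?_⟩
  · rw [h2] at h; exact h.left_of_append
  · exact h.right_of_append

lemma fol_congr {G : Type*} (f g : G → G) (l : List G) (e : G) (h : Fol f l e)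
    (hfg : ∀ x ∈ l, f x = g x) : Fol g l e := by
  unfold Fol at *
  rw [List.isChain_iff_getElem] at *
  intro i hi
  rw [← h i hi]
  have hi' : i < l.length := by simpa using hi
  rw [List.getElem_append_left hi']
  exact (hfg _ (List.getElem_mem hi')).symm

lemma good_of_fol (hN : 7 ≤ N) (W1 W2 n1 n2 : ℕ) (f : Perm (Perm (Fin N)))
    (h : ∀ x, x ∈ AA N 7 ↔ x ∈ path N W1 (n1+1) 1 ++ path N W2 (n2+1) (sg N 5))
    (d1 : dg W1 n1 = 7) (d2 : dg W2 n2 = 7)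
    (fx : ∀ x, x ∉ AA N 7 → f x = x)
    (f1 : Fol f (path N W1 (n1+1) 1) (fin N W1 (n1+1) 1))
    (f2 : Fol f (path N W2 (n2+1) (sg N 5)) (fin N W2 (n2+1) (sg N 5)))
    (cov : ∀ x ∈ AA N 7, f.SameCycle 1 x ∨ f.SameCycle (sg N 5) x) : Good N 7 f := by
  refine ⟨⟨fun x hx a ha => (AA N 7).mul_mem hx ha, fx, ?_⟩, ?_, ?_, cov⟩
  · intro x hx
    have := (h x).1 hx
    rw [List.mem_append] at this
    rcases this with hx | hx
    · exact fol_gen f _ _ _ f1 x hx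
    · exact fol_gen f _ _ _ f2 x hx
  · have := fol_head f _ _ _ f1
    rwa [d1, one_mul] at this
  · have := fol_head f _ _ _ f2
    rwa [d2] at this

lemma baseH (hN : 7 ≤ N) : ∃ H, Good N 7 H ∧ H.SameCycle 1 (sg N 5) := by
  obtain ⟨nd, c1, c2⟩ := two_paths hN WH1 WH2 2147 373 endr end1 _ _
    (fun x hx => endr_spec hN hx) (fun x hx => end1_spec hN hx) chkH
  have all := paths_all hN WH1 WH2 2147 373 (by norm_num) nd
  set l := path N WH1 2147 1 ++ path N WH2 373 (sg N 5) with hl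
  have F0 : Fol l.formPerm l 1 := fol_formPerm (1 : Perm (Fin N)) _ nd
  have hc := nd.isCycleOn_formPerm.2
  have hr : sg N 5 ∈ AA N 7 := sg_mem (by decide) (by omega)
  have sc : ∀ x ∈ AA N 7, l.formPerm.SameCycle 1 x := fun x hx =>
    hc ((all 1).1 (AA N 7).one_mem) ((all x).1 hx)
  obtain ⟨F1, F2⟩ := fol_append _ _ _ _ _ _ F0
  refine ⟨l.formPerm, ?_, sc _ hr⟩
  refine good_of_fol hN WH1 WH2 2146 372 _ all (by decide +kernel) (by decide +kernel) ?_ ?_ ?_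
    (fun x hx => Or.inl (sc x hx))
  · intro x hx
    exact List.formPerm_apply_of_notMem (fun h => hx ((all x).2 h))
  · rw [c1]; exact F1
  · rw [c2]; exact F2

lemma sc_of_agree {G : Type*} (f g : Perm G) (S : Set G) (hS : ∀ x ∈ S, f x ∈ S)
    (h : ∀ x ∈ S, g x = f x) {x y : G} (hx : x ∈ S) (hxy : f.SameCycle x y) [Finite G] :
    g.SameCycle x y := by
  cases nonempty_fintype G
  classical
  have := sc_closed {z | z ∈ S ∧ g.SameCycle x z} (f := f) ?_ hxy ⟨hx, SameCycle.refl g x⟩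
  · exact this.2
  · rintro z ⟨h1, h2⟩
    refine ⟨hS z h1, ?_⟩
    rw [← h z h1, sameCycle_apply_right]
    exact h2

lemma baseK (hN : 7 ≤ N) : ∃ K, Good N 7 K ∧ ¬ K.SameCycle 1 (sg N 5) := by
  obtain ⟨nd, c1, c2⟩ := two_paths hN WK1 WK2 1979 541 end1 endr _ _
    (fun x hx => end1_spec hN hx) (fun x hx => endr_spec hN hx) chkK
  have all := paths_all hN WK1 WK2 1979 541 (by norm_num) nd
  set l1 := path N WK1 1979 1 with hl1
  set l2 := path N WK2 541 (sg N 5) with hl2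
  rw [List.nodup_append] at nd
  obtain ⟨nd1, nd2, dis⟩ := nd
  have m1 : (1 : Perm (Fin N)) ∈ l1 := List.mem_cons_self
  have m2 : sg N 5 ∈ l2 := List.mem_cons_self
  have F1 : Fol l1.formPerm l1 1 := fol_formPerm (1 : Perm (Fin N)) _ nd1
  have F2 : Fol l2.formPerm l2 (sg N 5) := fol_formPerm (sg N 5) _ nd2
  have cl1 : ∀ x ∈ l1, l1.formPerm x ∈ l1 := fun x hx => List.formPerm_apply_mem_of_mem hx
  have cl2 : ∀ x ∈ l2, l2.formPerm x ∈ l2 := fun x hx => List.formPerm_apply_mem_of_mem hx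
  have K1 : ∀ x ∈ l1, (l1.formPerm * l2.formPerm) x = l1.formPerm x := by
    intro x hx
    rw [Perm.mul_apply, List.formPerm_apply_of_notMem (fun h => dis x hx x h rfl)]
  have K2 : ∀ x ∈ l2, (l1.formPerm * l2.formPerm) x = l2.formPerm x := by
    intro x hx
    rw [Perm.mul_apply, List.formPerm_apply_of_notMem (fun h => dis _ h _ (cl2 x hx) rfl)]
  refine ⟨l1.formPerm * l2.formPerm, ?_, ?_⟩
  · refine good_of_fol hN WK1 WK2 1978 540 _ all (by decide +kernel) (by decide +kernel) ?_ ?_ ?_ ?_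
    · intro x hx
      have h1 : x ∉ l1 := fun h => hx ((all x).2 (List.mem_append_left _ h))
      have h2 : x ∉ l2 := fun h => hx ((all x).2 (List.mem_append_right _ h))
      rw [Perm.mul_apply, List.formPerm_apply_of_notMem h2, List.formPerm_apply_of_notMem h1]
    · rw [c1]
      exact fol_congr _ _ _ _ F1 (fun x hx => (K1 x hx).symm)
    · rw [c2]
      exact fol_congr _ _ _ _ F2 (fun x hx => (K2 x hx).symm)
    · intro x hx
      rcases List.mem_append.1 ((all x).1 hx) with h | h
      · left
        exact sc_of_agree l1.formPerm _ {x | x ∈ l1} cl1 K1 m1 (nd1.isCycleOn_formPerm.2 m1 h)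
      · right
        exact sc_of_agree l2.formPerm _ {x | x ∈ l2} cl2 K2 m2 (nd2.isCycleOn_formPerm.2 m2 h)
  · intro h
    have : sg N 5 ∈ l1 := sc_closed {x | x ∈ l1}
      (fun x hx => by rw [K1 x hx]; exact cl1 x hx) h m1
    exact dis _ this _ m2 rfl

end base3
section final

lemma upper {n L : ℕ} (h7 : 7 ≤ n) {c : ZMod L → Perm (Fin n)} (hc : IsGoodCycle n L c) :
    L ≤ Nat.factorial n / 2 := by
  rcases Nat.eq_zero_or_pos L with rfl | hL
  · exact Nat.zero_le _
  have : NeZero L := ⟨by omega⟩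
  obtain ⟨inj, -, adj⟩ := hc
  set s : Perm (Fin n) := swap ⟨0, by omega⟩ ⟨0 + 1, by omega⟩ with hs
  have hs1 : IsAdjSwap n s := ⟨0, by omega, by omega, rfl⟩
  have hss : s * s = 1 := by simp [hs]
  have s1 : s ≠ 1 := by
    rw [hs, Ne, Perm.one_def, swap_eq_refl_iff]; simp
  have no : ∀ i j, c i * s ≠ c j := by
    intro i j e
    have e' : (c i)⁻¹ * c j = s := by rw [← e]; group
    by_cases hij : i = j
    · subst hij
      rw [inv_mul_cancel] at e'
      exact s1 e'.symm
    · exact adj i j hij (by rw [e']; exact hs1)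
  have hinj : Function.Injective (Sum.elim c (fun i => c i * s)) := by
    rintro (i | i) (j | j) e
    · exact congrArg _ (inj e)
    · exact absurd e.symm (no _ _)
    · exact absurd e (no _ _)
    · exact congrArg _ (inj (mul_right_cancel (a := c i) e))
  have := Fintype.card_le_of_injective _ hinj
  rw [Fintype.card_sum, ZMod.card, Fintype.card_perm, Fintype.card_fin] at this
  omega

lemma lower {n : ℕ} (h7 : 7 ≤ n) {H : Perm (Perm (Fin n))} (hH : Good n n H)
    (hc : H.SameCycle 1 (sg n (n-2))) :
    ∃ c : ZMod (Nat.factorial n / 2) → Perm (Fin n), IsGoodCycle n (Nat.factorial n / 2) c := by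
  classical
  have : Nontrivial (Fin n) := Fin.nontrivial_iff_two_le.2 (by omega)
  set T : Finset (Perm (Fin n)) := Finset.univ.filter (fun π => sign π = 1) with hT
  have memT : ∀ x, x ∈ T ↔ x ∈ AA n n := by
    intro x
    simp only [hT, Finset.mem_filter, Finset.mem_univ, true_and, mem_AA]
    exact ⟨fun h => ⟨h, fun i hi => absurd i.isLt (by omega)⟩, fun h => h.1⟩
  have cardT : T.card = Nat.factorial n / 2 := by
    have h1 := two_mul_card_alternatingGroup (α := Fin n)
    rw [Fintype.card_perm, Fintype.card_fin] at h1
    have h2 : T.card = Fintype.card (alternatingGroup (Fin n)) := by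
      rw [Fintype.card_subtype]
      congr 1
      ext x; simp [hT, mem_alternatingGroup]
    omega
  have all : ∀ x ∈ AA n n, H.SameCycle 1 x := fun x hx => by
    rcases hH.cov x hx with h | h
    · exact h
    · exact hc.trans h
  have cyc : H.IsCycleOn (T : Set (Perm (Fin n))) := by
    refine ⟨⟨?_, H.injective.injOn, ?_⟩, ?_⟩
    · intro x hx
      exact (memT _).2 (hH.part.cl x ((memT x).1 hx))
    · intro x hx
      refine ⟨H.symm x, ?_, by simp⟩
      by_contra hn
      have := hH.part.fix (H.symm x) (fun h => hn ((memT _).2 h))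
      rw [Equiv.apply_symm_apply] at this
      exact hn (this ▸ hx)
    · intro x hx y hy
      exact (all x ((memT x).1 hx)).symm.trans (all y ((memT y).1 hy))
  have oneT : (1 : Perm (Fin n)) ∈ T := (memT 1).2 (AA n n).one_mem
  have powT : ∀ k : ℕ, (H ^ k) 1 ∈ AA n n := by
    intro k
    induction k with
    | zero => simp [(AA n n).one_mem]
    | succ k ih => rw [pow_succ', Perm.mul_apply]; exact hH.part.cl _ ih
  have hpos : 0 < Nat.factorial n / 2 := by rw [← cardT]; exact Finset.card_pos.2 ⟨1, oneT⟩
  generalize hL : Nat.factorial n / 2 = L at *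
  have : NeZero L := ⟨by omega⟩
  have hmod : ∀ a b : ℕ, (H ^ a) 1 = (H ^ b) 1 ↔ (a : ZMod L) = b := by
    intro a b
    rw [cyc.pow_apply_eq_pow_apply oneT, cardT, ZMod.natCast_eq_natCast_iff]
  refine ⟨fun i => (H ^ i.val) 1, ?_, ?_, ?_⟩
  · intro i j e
    have := (hmod _ _).1 e
    simpa using this
  · intro i
    obtain ⟨t, ⟨k, -, h3, hk, rfl⟩, e⟩ := hH.part.gen _ (powT i.val)
    refine ⟨k, by omega, hk, ?_⟩
    show (H ^ (i+1).val) 1 = (H ^ i.val) 1 * tau n k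
    rw [← e, ← Perm.mul_apply, ← pow_succ', hmod]
    simp
  · rintro i j - ⟨a, h1, h2, e⟩
    have s1 := (powT i.val).1
    have s2 := (powT j.val).1
    have := congrArg sign e
    simp only at this
    rw [Perm.sign_mul, Perm.sign_inv, s1, s2, sign_swap (by simp)] at this
    simp at this

end final
end Snake

/-- For odd `n ≥ 7`, the maximum length `M_n` of a self-avoiding directed cycle in the
Cayley graph of `S_n` with generators `τ_2,…,τ_n`, subject to the constraint that no two
permutations on the cycle differ by an adjacent transposition, equals `n!/2`. -/
theorem max_cycle_length (n : ℕ) (hodd : Odd n) (h7 : 7 ≤ n) :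
    IsGreatest {L : ℕ | ∃ c : ZMod L → Equiv.Perm (Fin n), IsGoodCycle n L c}
      (Nat.factorial n / 2) := by
  constructor
  · obtain ⟨s, hs⟩ := hodd
    obtain ⟨t, rfl⟩ : ∃ t, n = 2 * t + 7 := ⟨s - 3, by omega⟩
    obtain ⟨H, gH, sH⟩ := Snake.baseH h7
    obtain ⟨K, gK, sK⟩ := Snake.baseK h7
    obtain ⟨H', -, gH', -, sH', -⟩ := Snake.climb ⟨H, K, gH, gK, sH, sK⟩ t le_rfl
    exact Snake.lower h7 gH' sH'
  · rintro L ⟨c, hc⟩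
    exact Snake.upper h7 hc
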